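/- arXiv:1403.0322 — 3 statements merged into one kernel-verified Lean document; each statement's English description precedes it below -/
import Mathlib

section
/- Let A = (-1,1), B = (0,1), D = (-1,0), O = (0,0) in ℝ². Let A₂ = (x₀,y₀) lie in the interior of the triangle ABD (so -1 < x₀ < 0, 0 < y₀ < 1, y₀ > x₀ + 1), let C = ((x₀ + 1 − y₀)/y₀, 1) be the intersection of the line through A₂ and D with the line y = 1, and let A₁ = (−t, 1) with 0 ≤ t ≤ (−x₀ + y₀ − 1)/y₀ (so A₁ lies on the segment from B to C). Let P be the 1-unconditional polygon with P ∩ {x ≤ 0, y ≥ 0} = conv{O, D, A₂, A₁, B}, and let R be the body of revolution about the X-axis generated by P. Similarly let R₁ and R₂ be the bodies of revolution generated by the 1-unconditional polygons P₁ and P₂ with P₁ ∩ {x ≤ 0, y ≥ 0} = conv{O, D, A₂, B} and P₂ ∩ {x ≤ 0, y ≥ 0} = conv{O, D, C, B}. Then P(R) ≥ min{P(R₁), P(R₂)}, where P(·) denotes the Mahler volume. -/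
open MeasureTheory Real Set

noncomputable def dot3 (x y : ℝ × ℝ × ℝ) : ℝ :=
  x.1 * y.1 + x.2.1 * y.2.1 + x.2.2 * y.2.2

def polar3 (K : Set (ℝ × ℝ × ℝ)) : Set (ℝ × ℝ × ℝ) :=
  {x | ∀ y ∈ K, dot3 x y ≤ 1}

/-- The Mahler volume of a body of revolution. -/
noncomputable def mahler3 (K : Set (ℝ × ℝ × ℝ)) : ENNReal :=
  volume K * volume (polar3 K)

/-- The 1-unconditional set determined by a subset `Q` of the quadrant
`{x ≤ 0, y ≥ 0}`: a point belongs to it iff `(-|x|, |y|) ∈ Q`. -/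
def uncondOf (Q : Set (ℝ × ℝ)) : Set (ℝ × ℝ) :=
  {p : ℝ × ℝ | ((-|p.1|, |p.2|) : ℝ × ℝ) ∈ Q}

/-- The body of revolution about the X-axis generated by a planar set `D`. -/
def revolution (D : Set (ℝ × ℝ)) : Set (ℝ × ℝ × ℝ) :=
  {p : ℝ × ℝ × ℝ | ((p.1, Real.sqrt (p.2.1 ^ 2 + p.2.2 ^ 2)) : ℝ × ℝ) ∈ D}

theorem volume_sqrt_sq_add_sq_le {r : ℝ} (hr : 0 ≤ r) :
    volume {q : ℝ × ℝ | √(q.1 ^ 2 + q.2 ^ 2) ≤ r} = ENNReal.ofReal (π * r ^ 2) := by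
  have h := Complex.volume_preserving_equiv_real_prod.symm
  have h2 := h.measure_preimage_equiv (Metric.closedBall (0 : ℂ) r)
  rw [Complex.volume_closedBall] at h2
  have h3 : Complex.measurableEquivRealProd.symm ⁻¹' Metric.closedBall (0 : ℂ) r
      = {q : ℝ × ℝ | √(q.1 ^ 2 + q.2 ^ 2) ≤ r} := by
    ext q
    simp [Complex.norm_eq_sqrt_sq_add_sq, Complex.measurableEquivRealProd]
  rw [h3] at h2
  rw [h2, mul_comm π, ENNReal.ofReal_mul (by positivity), ENNReal.ofReal_pow hr]
  congr 1
  rw [← NNReal.coe_real_pi, ENNReal.ofReal_coe_nnreal]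

theorem volume_solid_of_revolution {f : ℝ → ℝ} (hf : Continuous f)
    (hf0 : ∀ x, 0 ≤ x → x ≤ 1 → 0 ≤ f x) :
    volume {p : ℝ × ℝ × ℝ | |p.1| ≤ 1 ∧ √(p.2.1 ^ 2 + p.2.2 ^ 2) ≤ f |p.1|}
      = ENNReal.ofReal (2 * π * ∫ x in (0 : ℝ)..1, f x ^ 2) := by
  have hclosed : IsClosed
      {p : ℝ × ℝ × ℝ | |p.1| ≤ 1 ∧ √(p.2.1 ^ 2 + p.2.2 ^ 2) ≤ f |p.1|} :=
    IsClosed.and (isClosed_le (by fun_prop) continuous_const)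
      (isClosed_le (by fun_prop) (by fun_prop))
  have hcont : Continuous fun x : ℝ => π * f |x| ^ 2 := by fun_prop
  have hsec : ∀ x : ℝ, volume (Prod.mk x ⁻¹'
      {p : ℝ × ℝ × ℝ | |p.1| ≤ 1 ∧ √(p.2.1 ^ 2 + p.2.2 ^ 2) ≤ f |p.1|})
      = (Icc (-1 : ℝ) 1).indicator (fun x => ENNReal.ofReal (π * f |x| ^ 2)) x := by
    intro x
    by_cases hx : |x| ≤ 1
    · rw [indicator_of_mem (show x ∈ Icc (-1 : ℝ) 1 from abs_le.mp hx),
        ← volume_sqrt_sq_add_sq_le (hf0 _ (abs_nonneg x) hx)]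
      simp [hx]
    · rw [indicator_of_notMem (show x ∉ Icc (-1 : ℝ) 1 from fun h => hx (abs_le.mpr h))]
      simp [hx]
  rw [Measure.volume_eq_prod, Measure.prod_apply hclosed.measurableSet]
  simp_rw [hsec]
  rw [lintegral_indicator measurableSet_Icc, ← ofReal_integral_eq_lintegral_ofReal
    hcont.integrableOn_Icc (ae_of_all _ fun x => by positivity),
    integral_Icc_eq_integral_Ioc, ← intervalIntegral.integral_of_le (by norm_num)]
  congr 1
  have hpos : ∫ x in (0 : ℝ)..1, π * f |x| ^ 2 = π * ∫ x in (0 : ℝ)..1, f x ^ 2 := by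
    rw [← intervalIntegral.integral_const_mul]
    refine intervalIntegral.integral_congr fun x hx => ?_
    rw [uIcc_of_le zero_le_one] at hx
    simp only [abs_of_nonneg hx.1]
  have hneg : ∫ x in (-1 : ℝ)..0, π * f |x| ^ 2 = ∫ x in (0 : ℝ)..1, π * f |x| ^ 2 := by
    have h := intervalIntegral.integral_comp_neg
      (a := (0 : ℝ)) (b := 1) (fun x => π * f |x| ^ 2)
    simp only [abs_neg, neg_zero] at h
    exact h.symm
  rw [← intervalIntegral.integral_add_adjacent_intervals (b := 0)
    (hcont.intervalIntegrable _ _) (hcont.intervalIntegrable _ _), hneg, hpos]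
  ring

theorem integral_linear_sq (m k s s' : ℝ) :
    ∫ x in s..s', (m * x + k) ^ 2 = (s' - s) *
      ((m * s + k) ^ 2 + (m * s + k) * (m * s' + k) + (m * s' + k) ^ 2) / 3 := by
  have h : ∀ x ∈ uIcc s s', HasDerivAt
      (fun x : ℝ => m ^ 2 * x ^ 3 / 3 + m * k * x ^ 2 + k ^ 2 * x) ((m * x + k) ^ 2) x := by
    intro x _
    have h1 := (((hasDerivAt_pow 3 x).const_mul (m ^ 2)).div_const 3).add
      (((hasDerivAt_pow 2 x).const_mul (m * k)).add ((hasDerivAt_id x).const_mul (k ^ 2)))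
    refine HasDerivAt.congr_deriv (h1.congr_of_eventuallyEq (.of_forall fun y => ?_)) ?_
    · simp only [Pi.add_apply, id]; ring
    · push_cast; ring
  rw [intervalIntegral.integral_eq_sub_of_hasDerivAt h
    ((by fun_prop : Continuous fun x : ℝ => (m * x + k) ^ 2).intervalIntegrable _ _)]
  ring

theorem integral_sq_of_eqOn_linear {f : ℝ → ℝ} {s s' : ℝ} (m k : ℝ) (hs : s ≤ s')
    (h : ∀ x, s ≤ x → x ≤ s' → f x = m * x + k) :
    ∫ x in s..s', f x ^ 2 = (s' - s) * (f s ^ 2 + f s * f s' + f s' ^ 2) / 3 := by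
  rw [h s le_rfl hs, h s' hs le_rfl, ← integral_linear_sq]
  refine intervalIntegral.integral_congr fun x hx => ?_
  rw [uIcc_of_le hs] at hx
  simp only [h x hx.1 hx.2]

theorem le_of_mem_convexHull {S : Set (ℝ × ℝ)} {α β γ : ℝ}
    (h : ∀ p ∈ S, -p.1 * α + p.2 * β ≤ γ) {p : ℝ × ℝ} (hp : p ∈ convexHull ℝ S) :
    -p.1 * α + p.2 * β ≤ γ := by
  have hconv : Convex ℝ {p : ℝ × ℝ | -p.1 * α + p.2 * β ≤ γ} := by
    refine convex_halfSpace_le (f := fun p : ℝ × ℝ => -p.1 * α + p.2 * β)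
      ⟨fun p q => ?_, fun c p => ?_⟩ γ
    · simp; ring
    · simp; ring
  exact convexHull_min h hconv hp

theorem mem_polar3_revolution_uncondOf_convexHull {S : Set (ℝ × ℝ)}
    (hS : ∀ p ∈ S, p.1 ≤ 0 ∧ 0 ≤ p.2) (z : ℝ × ℝ × ℝ) :
    z ∈ polar3 (revolution (uncondOf (convexHull ℝ S))) ↔
      ∀ p ∈ S, -p.1 * |z.1| + p.2 * √(z.2.1 ^ 2 + z.2.2 ^ 2) ≤ 1 := by
  obtain ⟨u, v, w⟩ := z
  simp only [polar3, revolution, uncondOf, dot3, mem_ofPred_eq]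
  constructor
  · intro h p hp
    obtain ⟨hp1, hp2⟩ := hS p hp
    obtain ⟨y, z, hyz, hdot⟩ : ∃ y z : ℝ, y ^ 2 + z ^ 2 = p.2 ^ 2 ∧
        v * y + w * z = p.2 * √(v ^ 2 + w ^ 2) := by
      rcases eq_or_ne (√(v ^ 2 + w ^ 2)) 0 with h0 | h0
      · have h1 : v ^ 2 + w ^ 2 = 0 := (Real.sqrt_eq_zero (by positivity)).mp h0
        have hv : v = 0 := by nlinarith [sq_nonneg v, sq_nonneg w]
        have hw : w = 0 := by nlinarith [sq_nonneg v, sq_nonneg w]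
        exact ⟨p.2, 0, by ring, by simp [hv, hw]⟩
      · have h1 : √(v ^ 2 + w ^ 2) ^ 2 = v ^ 2 + w ^ 2 := Real.sq_sqrt (by positivity)
        generalize √(v ^ 2 + w ^ 2) = ρ at h0 h1
        refine ⟨p.2 * v / ρ, p.2 * w / ρ, ?_, ?_⟩
        · field_simp
          rw [h1]
        · field_simp
          rw [h1]
    have hmem : ∀ x, |x| = -p.1 → (-|x|, |√(y ^ 2 + z ^ 2)|) ∈ convexHull ℝ S := by
      intro x hx
      rw [hyz, Real.sqrt_sq hp2, hx, neg_neg, abs_of_nonneg hp2]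
      exact subset_convexHull ℝ S hp
    rcases abs_cases u with ⟨hu, _⟩ | ⟨hu, _⟩ <;> rw [hu]
    · have := h (-p.1, y, z) (hmem _ (abs_of_nonneg (by linarith)))
      dsimp only at this
      linarith
    · have := h (p.1, y, z) (hmem _ (abs_of_nonpos hp1))
      dsimp only at this
      linarith
  · rintro h ⟨x, y, z⟩ hmem
    dsimp only at hmem ⊢
    have hle := le_of_mem_convexHull h hmem
    dsimp only at hle
    rw [neg_neg, abs_of_nonneg (Real.sqrt_nonneg _)] at hle
    have hux : u * x ≤ |x| * |u| := by rw [← abs_mul, mul_comm u]; exact le_abs_self _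
    have hcs : v * y + w * z ≤ √(y ^ 2 + z ^ 2) * √(v ^ 2 + w ^ 2) := by
      rw [← Real.sqrt_mul (by positivity)]
      apply Real.le_sqrt_of_sq_le
      nlinarith [sq_nonneg (v * z - w * y)]
    linarith

theorem min_endpoints_le_of_rational {K₀ K₁ K₂ K₃ p₀ p : ℝ} (hp₀ : 0 < p₀) (hp : p₀ ≤ p)
    (hp1 : p ≤ 1) (hK₂ : 0 ≤ K₂) (hK : K₃ < K₂ → K₁ + 2 * K₂ + K₃ ≤ 0) :
    K₀ + K₁ * p₀ + K₂ * p₀ ^ 2 - K₃ / p₀ ≤ K₀ + K₁ * p + K₂ * p ^ 2 - K₃ / p ∨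
      K₀ + K₁ + K₂ - K₃ ≤ K₀ + K₁ * p + K₂ * p ^ 2 - K₃ / p := by
  have hp0 : 0 < p := hp₀.trans_le hp
  have e1 : K₀ + K₁ * p + K₂ * p ^ 2 - K₃ / p - (K₀ + K₁ + K₂ - K₃)
      = (1 - p) * -(K₁ + K₂ * (1 + p) + K₃ / p) := by field_simp; ring
  have e2 : K₀ + K₁ * p + K₂ * p ^ 2 - K₃ / p - (K₀ + K₁ * p₀ + K₂ * p₀ ^ 2 - K₃ / p₀)
      = (p - p₀) * ((K₁ + K₂ * (1 + p) + K₃ / p)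
          + (1 - p₀) * (K₃ - K₂ * (p * p₀)) / (p * p₀)) := by
    field_simp; ring
  rcases le_or_gt (K₁ + K₂ * (1 + p) + K₃ / p) 0 with hM | hM
  · right
    have := mul_nonneg (sub_nonneg.mpr hp1) (neg_nonneg.mpr hM)
    linarith
  · left
    have h : K₂ * (p * p₀) ≤ K₃ := by
      by_contra! hlt
      have hlt' : K₃ < K₂ * p := by
        nlinarith [mul_nonneg hK₂ hp0.le,
          mul_nonneg (mul_nonneg hK₂ hp0.le) (sub_nonneg.mpr (hp.trans hp1))]
      have hdiv : K₃ / p < K₂ := by rwa [div_lt_iff₀ hp0]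
      have h1 := hK (by nlinarith)
      have e3 : K₁ + K₂ * (1 + p) + K₃ / p - (K₁ + 2 * K₂ + K₃) = (1 - p) * (K₃ / p - K₂) := by
        field_simp; ring
      nlinarith [mul_nonneg (sub_nonneg.mpr hp1) (sub_nonneg.mpr hdiv.le)]
    have h2 : 0 ≤ (1 - p₀) * (K₃ - K₂ * (p * p₀)) / (p * p₀) :=
      div_nonneg (mul_nonneg (by linarith) (by linarith)) (by positivity)
    have := mul_nonneg (sub_nonneg.mpr hp) (add_nonneg hM.le h2)
    linarith

/-- The integral of the squared profile of the pentagon with vertices `(t, 1)`, `(a, b)`. -/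
noncomputable def profileIntegral (a b t : ℝ) : ℝ :=
  (t * (2 - b - b ^ 2) + a * (1 + b) + b ^ 2) / 3

/-- The integral of the squared profile of the polar of the pentagon with vertices
`(t, 1)`, `(a, b)`. -/
noncomputable def polarProfileIntegral (a b t : ℝ) : ℝ :=
  (a * (1 - b) * ((1 - b) / (a - b * t)) ^ 2
    - (1 - b) * (2 + b) * ((1 - b) / (a - b * t)) + (3 - 3 * a + a ^ 2)) / (3 * b ^ 2)

theorem profileIntegral_mul_polarProfileIntegral {a b t p : ℝ} (hb : b ≠ 0) (hp : p ≠ 0)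
    (hat : a - b * t ≠ 0) (hpt : p * (a - b * t) = 1 - b) :
    profileIntegral a b t * polarProfileIntegral a b t =
      (((2 * a + b ^ 3) * (3 - 3 * a + a ^ 2) + (1 - b) ^ 3 * (2 + b) ^ 2)
        + (-(2 * a + b ^ 3) * ((1 - b) * (2 + b)) - a * (1 - b) ^ 3 * (2 + b)) * p
        + (2 * a + b ^ 3) * (a * (1 - b)) * p ^ 2
        - (1 - b) ^ 2 * (2 + b) * (3 - 3 * a + a ^ 2) / p) / (9 * b ^ 3) := by
  have h1 : (1 - b) / (a - b * t) = p := by rw [← hpt]; field_simp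
  have ht : t = (a - (1 - b) / p) / b := by rw [← hpt]; field_simp; ring
  rw [profileIntegral, polarProfileIntegral, h1, ht]
  field_simp
  ring

theorem min_endpoints_le_profileIntegral_mul {a b t : ℝ} (ha : 0 < a) (ha1 : a < 1) (hb : 0 < b)
    (hb1 : b < 1) (hab : 1 - a < b) (ht : 0 ≤ t) (htb : b * t ≤ a + b - 1) :
    profileIntegral a b 0 * polarProfileIntegral a b 0
        ≤ profileIntegral a b t * polarProfileIntegral a b t ∨
      profileIntegral a b ((a + b - 1) / b) * polarProfileIntegral a b ((a + b - 1) / b)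
        ≤ profileIntegral a b t * polarProfileIntegral a b t := by
  have hat : 0 < a - b * t := by linarith
  have hbt : 0 ≤ b * t := by positivity
  have hd : 0 < 1 - b := by linarith
  have hp0 : 0 < (1 - b) / (a - b * t) := div_pos hd hat
  have hc : b * ((a + b - 1) / b) = a + b - 1 := by field_simp
  rw [profileIntegral_mul_polarProfileIntegral (p := (1 - b) / a) hb.ne' (by positivity)
      (by simpa using ha.ne') (by simp; field_simp),
    profileIntegral_mul_polarProfileIntegral (p := (1 - b) / (a - b * t)) hb.ne' hp0.ne'
      hat.ne' (by field_simp),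
    profileIntegral_mul_polarProfileIntegral (p := 1) (t := (a + b - 1) / b) hb.ne' one_ne_zero
      (by rw [hc]; linarith) (by rw [hc]; ring)]
  have hC : 0 < 3 - 3 * a + a ^ 2 := by nlinarith
  have key := min_endpoints_le_of_rational
    (K₀ := (2 * a + b ^ 3) * (3 - 3 * a + a ^ 2) + (1 - b) ^ 3 * (2 + b) ^ 2)
    (K₁ := -(2 * a + b ^ 3) * ((1 - b) * (2 + b)) - a * (1 - b) ^ 3 * (2 + b))
    (K₂ := (2 * a + b ^ 3) * (a * (1 - b)))
    (K₃ := (1 - b) ^ 2 * (2 + b) * (3 - 3 * a + a ^ 2))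
    (p₀ := (1 - b) / a) (p := (1 - b) / (a - b * t)) (by positivity)
    (div_le_div_of_nonneg_left hd.le hat (by linarith))
    (by rw [div_le_one hat]; linarith) (by positivity) (by
      intro h
      have h2 : 0 < (1 - b) * ((2 * a + b ^ 3) * a - (1 - b) * (2 + b) * (3 - 3 * a + a ^ 2)) := by
        linarith
      have h2' := pos_of_mul_pos_right h2 hd.le
      have hr : 0 < 1 - a := by linarith
      obtain ⟨r, rfl⟩ : ∃ r, a = 1 - r := ⟨1 - a, by ring⟩
      simp only [sub_sub_cancel] at hr hab
      have hr1 : r ^ 3 ≤ b := by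
        have : r ^ 3 ≤ r := by
          have := pow_le_pow_of_le_one hr.le (by linarith : r ≤ 1) (by norm_num : 1 ≤ 3)
          simpa using this
        linarith
      have h3 := mul_le_mul_of_nonneg_left hr1 (by positivity : 0 ≤ b + b ^ 2)
      have h4 := mul_pos hr h2'
      have h5 : 0 < r * b := by positivity
      have h6 : 0 < b ^ 3 * r ^ 2 := by positivity
      have h7 : 0 < b ^ 4 := by positivity
      have h8 : (2 * (1 - r) + b ^ 3) * (2 * (1 - r) - (2 + b))
          - (1 - r) * (1 - b) ^ 2 * (2 + b)
          + (1 - b) * (2 + b) * (3 - 3 * (1 - r) + (1 - r) ^ 2) ≤ 0 := by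
        nlinarith
      have h9 := mul_nonneg hd.le (neg_nonneg.mpr h8)
      linarith)
  simp only [mul_one, one_pow, div_one]
  have h9 : (0 : ℝ) ≤ 9 * b ^ 3 := by positivity
  exact key.imp (fun h => div_le_div_of_nonneg_right h h9) (fun h => div_le_div_of_nonneg_right h h9)

/-- The upper boundary, as a function of `|x|`, of the pentagon with vertices
`(t, 1)`, `(a, b)`. -/
noncomputable def profile (a b t x : ℝ) : ℝ :=
  min 1 (min ((a - b * t - (1 - b) * x) / (a - t)) (b * (1 - x) / (1 - a)))

/-- The upper boundary of the polar of the pentagon with vertices `(t, 1)`, `(a, b)`. -/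
noncomputable def polarProfile (a b t x : ℝ) : ℝ :=
  min (1 - t * x) ((1 - a * x) / b)

/-- The quadrant part of the pentagon. -/
def pentagon (a b t : ℝ) : Set (ℝ × ℝ) :=
  convexHull ℝ {((0 : ℝ), (0 : ℝ)), (-1, 0), (-a, b), (-t, 1), (0, 1)}

theorem Convex.lineMap_height_mem {C : Set (ℝ × ℝ)} (hC : Convex ℝ C) {s s' u u' x : ℝ}
    (h : (-s, u) ∈ C) (h' : (-s', u') ∈ C) (hs : s ≤ x) (hs' : x ≤ s') (hlt : s < s') :
    (-x, (u * (s' - x) + u' * (x - s)) / (s' - s)) ∈ C := by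
  have hd : 0 < s' - s := sub_pos.mpr hlt
  have := hC h h' (div_nonneg (sub_nonneg.mpr hs') hd.le) (div_nonneg (sub_nonneg.mpr hs) hd.le)
    (by field_simp; ring)
  convert this using 1
  ext
  · simp; field_simp; ring
  · simp; field_simp

theorem Convex.mem_of_height_le {C : Set (ℝ × ℝ)} (hC : Convex ℝ C) {x r h : ℝ}
    (h0 : (x, (0 : ℝ)) ∈ C) (hh : (x, h) ∈ C) (hr : 0 ≤ r) (hrh : r ≤ h) : (x, r) ∈ C := by
  rcases hr.eq_or_lt with rfl | hr
  · exact h0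
  have hpos : 0 < h := hr.trans_le hrh
  have := hC h0 hh (div_nonneg (sub_nonneg.mpr hrh) hpos.le) (div_nonneg hr.le hpos.le)
    (by field_simp; ring)
  convert this using 1
  ext
  · simp; field_simp; ring
  · simp; field_simp

section Pentagon

variable {a b t : ℝ}

theorem mem_pentagon_iff (ha1 : a < 1) (hb1 : b < 1) (hab : 1 - a < b) (ht : 0 ≤ t)
    (hta : t < a) (htb : b * t ≤ a + b - 1) {x r : ℝ} (hx : 0 ≤ x) (hr : 0 ≤ r) :
    (-x, r) ∈ pentagon a b t ↔ x ≤ 1 ∧ r ≤ profile a b t x := by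
  have h1a : 0 < 1 - a := by linarith
  have hat : 0 < a - t := by linarith
  rw [profile, le_min_iff, le_min_iff, le_div_iff₀ hat, le_div_iff₀ h1a]
  constructor
  · intro h
    have hbt : b * t ≤ t := by nlinarith
    have h1 := le_of_mem_convexHull (α := 1) (β := 0) (γ := 1) (by
      simp only [mem_insert_iff, mem_singleton_iff, forall_eq_or_imp, forall_eq]
      refine ⟨?_, ?_, ?_, ?_, ?_⟩ <;> linarith) h
    have h2 := le_of_mem_convexHull (α := 0) (β := 1) (γ := 1) (by
      simp only [mem_insert_iff, mem_singleton_iff, forall_eq_or_imp, forall_eq]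
      refine ⟨?_, ?_, ?_, ?_, ?_⟩ <;> linarith) h
    have h3 := le_of_mem_convexHull (α := 1 - b) (β := a - t) (γ := a - b * t) (by
      simp only [mem_insert_iff, mem_singleton_iff, forall_eq_or_imp, forall_eq]
      refine ⟨?_, ?_, ?_, ?_, ?_⟩ <;> linarith) h
    have h4 := le_of_mem_convexHull (α := b) (β := 1 - a) (γ := b) (by
      simp only [mem_insert_iff, mem_singleton_iff, forall_eq_or_imp, forall_eq]
      refine ⟨?_, ?_, ?_, ?_, ?_⟩ <;> linarith) h
    dsimp only at h1 h2 h3 h4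
    refine ⟨?_, ?_, ?_, ?_⟩ <;> linarith
  · rintro ⟨hx1, hr1, hr2, hr3⟩
    have hconv : Convex ℝ (pentagon a b t) := convex_convexHull ℝ _
    have hO : (-0, 0) ∈ pentagon a b t := subset_convexHull ℝ _ (by simp)
    have hD : (-1, 0) ∈ pentagon a b t := subset_convexHull ℝ _ (by simp)
    have hA₂ : (-a, b) ∈ pentagon a b t := subset_convexHull ℝ _ (by simp)
    have hA₁ : (-t, 1) ∈ pentagon a b t := subset_convexHull ℝ _ (by simp)
    have hB : (-0, 1) ∈ pentagon a b t := subset_convexHull ℝ _ (by simp)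
    have h0 : (-x, 0) ∈ pentagon a b t := by
      simpa using hconv.lineMap_height_mem hO hD hx hx1 one_pos
    rcases le_or_gt x t with hxt | hxt
    · have h1 : (-x, 1) ∈ pentagon a b t := by
        rcases ht.eq_or_lt with rfl | ht
        · rwa [le_antisymm hxt hx]
        · have := hconv.lineMap_height_mem hB hA₁ hx hxt ht
          convert this using 2
          field_simp
          ring
      exact hconv.mem_of_height_le h0 h1 hr hr1
    rcases le_or_gt x a with hxa | hxa
    · refine hconv.mem_of_height_le h0 (hconv.lineMap_height_mem hA₁ hA₂ hxt.le hxa hta) hr ?_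
      rw [le_div_iff₀ hat]
      linarith
    · refine hconv.mem_of_height_le h0 (hconv.lineMap_height_mem hA₂ hD hxa.le hx1 ha1) hr ?_
      rw [le_div_iff₀ h1a]
      linarith

theorem integral_profile_sq (ha1 : a < 1) (hb1 : b < 1) (ht : 0 ≤ t)
    (hta : t < a) (htb : b * t ≤ a + b - 1) :
    ∫ x in (0 : ℝ)..1, profile a b t x ^ 2 = profileIntegral a b t := by
  have h1a : 0 < 1 - a := by linarith
  have hat : 0 < a - t := by linarith
  have hcont : Continuous fun x => profile a b t x ^ 2 := by unfold profile; fun_prop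
  have hp1 : ∀ x, 0 ≤ x → x ≤ t → profile a b t x = 0 * x + 1 := by
    intro x hx hxt
    rw [profile, min_eq_left, zero_mul, zero_add]
    rw [le_min_iff, le_div_iff₀ hat, le_div_iff₀ h1a]
    constructor <;> nlinarith
  have hp2 : ∀ x, t ≤ x → x ≤ a →
      profile a b t x = -(1 - b) / (a - t) * x + (a - b * t) / (a - t) := by
    intro x hxt hxa
    rw [profile, min_eq_right, min_eq_left]
    · field_simp
      ring
    · rw [div_le_div_iff₀ hat h1a]
      nlinarith [mul_nonneg (sub_nonneg.mpr hxa) (sub_nonneg.mpr htb)]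
    · refine (min_le_left _ _).trans ?_
      rw [div_le_one hat]
      nlinarith
  have hp3 : ∀ x, a ≤ x → x ≤ 1 → profile a b t x = -b / (1 - a) * x + b / (1 - a) := by
    intro x hxa hx1
    have hle : b * (1 - x) / (1 - a) ≤ (a - b * t - (1 - b) * x) / (a - t) := by
      rw [div_le_div_iff₀ h1a hat]
      nlinarith [mul_nonneg (sub_nonneg.mpr hxa) (sub_nonneg.mpr htb)]
    rw [profile, min_eq_right hle, min_eq_right]
    · field_simp
      ring
    · rw [div_le_one h1a]
      nlinarith
  have h0 : profile a b t 0 = 1 := by rw [hp1 0 le_rfl ht]; ring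
  have ht' : profile a b t t = 1 := by rw [hp1 t ht le_rfl]; ring
  have ha' : profile a b t a = b := by rw [hp3 a le_rfl ha1.le]; field_simp; ring
  have h1' : profile a b t 1 = 0 := by rw [hp3 1 ha1.le le_rfl]; ring
  rw [← intervalIntegral.integral_add_adjacent_intervals (b := a)
      (hcont.intervalIntegrable _ _) (hcont.intervalIntegrable _ _),
    ← intervalIntegral.integral_add_adjacent_intervals (a := 0) (b := t) (c := a)
      (hcont.intervalIntegrable _ _) (hcont.intervalIntegrable _ _),
    integral_sq_of_eqOn_linear _ _ ht hp1, integral_sq_of_eqOn_linear _ _ hta.le hp2,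
    integral_sq_of_eqOn_linear _ _ ha1.le hp3, h0, ht', ha', h1', profileIntegral]
  ring

theorem integral_polarProfile_sq (hb : 0 < b) (hb1 : b < 1) (htb : b * t ≤ a + b - 1) :
    ∫ x in (0 : ℝ)..1, polarProfile a b t x ^ 2 = polarProfileIntegral a b t := by
  have hat : 0 < a - b * t := by linarith
  have hp0 : 0 ≤ (1 - b) / (a - b * t) := div_nonneg (by linarith) hat.le
  have hp1 : (1 - b) / (a - b * t) ≤ 1 := by rw [div_le_one hat]; linarith
  have hpt : (1 - b) / (a - b * t) * (a - b * t) = 1 - b := by field_simp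
  rw [polarProfileIntegral]
  generalize (1 - b) / (a - b * t) = p at hp0 hp1 hpt ⊢
  have hcont : Continuous fun x => polarProfile a b t x ^ 2 := by unfold polarProfile; fun_prop
  have h1 : ∀ x, 0 ≤ x → x ≤ p → polarProfile a b t x = -t * x + 1 := by
    intro x _ hxp
    rw [polarProfile, min_eq_left]
    · ring
    · rw [le_div_iff₀ hb]
      nlinarith
  have h2 : ∀ x, p ≤ x → x ≤ 1 → polarProfile a b t x = -a / b * x + 1 / b := by
    intro x hxp _
    rw [polarProfile, min_eq_right]
    · field_simp
      ring
    · rw [div_le_iff₀ hb]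
      nlinarith
  have e0 : polarProfile a b t 0 = 1 := by rw [h1 0 le_rfl hp0]; ring
  have ep : polarProfile a b t p = (1 - a * p) / b := by rw [h2 p le_rfl hp1]; ring
  have e1 : polarProfile a b t 1 = (1 - a) / b := by rw [h2 1 hp1 le_rfl]; ring
  rw [← intervalIntegral.integral_add_adjacent_intervals (b := p)
      (hcont.intervalIntegrable _ _) (hcont.intervalIntegrable _ _),
    integral_sq_of_eqOn_linear _ _ hp0 h1, integral_sq_of_eqOn_linear _ _ hp1 h2, e0, ep, e1]
  field_simp
  ring

theorem mahler3_revolution_pentagon (ha1 : a < 1) (hb : 0 < b) (hb1 : b < 1) (hab : 1 - a < b)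
    (ht : 0 ≤ t) (htb : b * t ≤ a + b - 1) :
    mahler3 (revolution (uncondOf (pentagon a b t))) =
      ENNReal.ofReal ((2 * π) ^ 2 * (profileIntegral a b t * polarProfileIntegral a b t)) := by
  have hta : t < a := by nlinarith
  have h1a : 0 < 1 - a := by linarith
  have hat : 0 < a - t := by linarith
  have hbody : revolution (uncondOf (pentagon a b t)) =
      {p | |p.1| ≤ 1 ∧ √(p.2.1 ^ 2 + p.2.2 ^ 2) ≤ profile a b t |p.1|} := by
    ext p
    simp only [revolution, uncondOf, mem_ofPred_eq]
    rw [abs_of_nonneg (Real.sqrt_nonneg _)]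
    exact mem_pentagon_iff ha1 hb1 hab ht hta htb (abs_nonneg _) (Real.sqrt_nonneg _)
  have hpolar : polar3 (revolution (uncondOf (pentagon a b t))) =
      {p | |p.1| ≤ 1 ∧ √(p.2.1 ^ 2 + p.2.2 ^ 2) ≤ polarProfile a b t |p.1|} := by
    ext p
    rw [pentagon, mem_polar3_revolution_uncondOf_convexHull]
    · simp only [mem_insert_iff, mem_singleton_iff, forall_eq_or_imp, forall_eq, mem_ofPred_eq]
      rw [polarProfile, le_min_iff, le_div_iff₀ hb]
      have hu : 0 ≤ t * |p.1| := mul_nonneg ht (abs_nonneg _)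
      constructor
      · rintro ⟨_, h1, h2, h3, _⟩
        refine ⟨?_, ?_, ?_⟩ <;> linarith
      · rintro ⟨h1, h2, h3⟩
        refine ⟨?_, ?_, ?_, ?_, ?_⟩ <;> linarith
    · simp only [mem_insert_iff, mem_singleton_iff, forall_eq_or_imp, forall_eq]
      refine ⟨⟨?_, ?_⟩, ⟨?_, ?_⟩, ⟨?_, ?_⟩, ⟨?_, ?_⟩, ⟨?_, ?_⟩⟩ <;> linarith
  have hvol : volume (revolution (uncondOf (pentagon a b t))) =
      ENNReal.ofReal (2 * π * profileIntegral a b t) := by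
    rw [hbody, volume_solid_of_revolution (by unfold profile; fun_prop),
      integral_profile_sq ha1 hb1 ht hta htb]
    intro x hx hx1
    refine le_min zero_le_one (le_min (div_nonneg ?_ hat.le) (div_nonneg ?_ h1a.le)) <;> nlinarith
  have hvol' : volume (polar3 (revolution (uncondOf (pentagon a b t)))) =
      ENNReal.ofReal (2 * π * polarProfileIntegral a b t) := by
    rw [hpolar, volume_solid_of_revolution (by unfold polarProfile; fun_prop),
      integral_polarProfile_sq hb hb1 htb]
    intro x hx hx1
    refine le_min ?_ (div_nonneg ?_ hb.le) <;> nlinarith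
  have hnn : 0 ≤ profileIntegral a b t := by
    rw [← integral_profile_sq ha1 hb1 ht hta htb]
    exact intervalIntegral.integral_nonneg zero_le_one fun x _ => sq_nonneg _
  rw [mahler3, hvol, hvol', ← ENNReal.ofReal_mul (by positivity)]
  congr 1
  ring

theorem pentagon_zero :
    pentagon a b 0 = convexHull ℝ {((0 : ℝ), (0 : ℝ)), (-1, 0), (-a, b), (0, 1)} := by
  simp [pentagon]

theorem pentagon_of_collinear (hb : 0 < b) (hb1 : b ≤ 1) :
    pentagon a b ((a + b - 1) / b) =
      convexHull ℝ {((0 : ℝ), (0 : ℝ)), (-1, 0), (-((a + b - 1) / b), 1), (0, 1)} := by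
  refine (convexHull_min ?_ (convex_convexHull ℝ _)).antisymm (convexHull_mono ?_)
  · have hsub := subset_convexHull ℝ
      {((0 : ℝ), (0 : ℝ)), (-1, 0), (-((a + b - 1) / b), 1), (0, 1)}
    simp only [insert_subset_iff, singleton_subset_iff] at hsub ⊢
    obtain ⟨hO, hD, hC, hB⟩ := hsub
    refine ⟨hO, hD, ?_, hC, hB⟩
    have := convex_convexHull ℝ _ hD hC (sub_nonneg.mpr hb1) hb.le (by ring)
    convert this using 1
    ext
    · simp; field_simp; ring
    · simp
  · intro p
    simp only [mem_insert_iff, mem_singleton_iff]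
    tauto

end Pentagon

/-- Lemma 3.4 of the paper: with `A₂ = (x₀,y₀)` interior to the triangle `ABD`,
`A₁ = (-t,1)` on the segment from `B` to `C`, and `P`, `P₁`, `P₂` the
1-unconditional polygons with quadrant parts `conv{O,D,A₂,A₁,B}`, `conv{O,D,A₂,B}`
and `conv{O,D,C,B}`, the Mahler volume of the body of revolution generated by `P`
is at least the minimum of those generated by `P₁` and `P₂`. -/
theorem mahler_min_pentagon (x₀ y₀ t : ℝ)
    (hx₀ : -1 < x₀) (hx₀' : x₀ < 0) (hy₀ : 0 < y₀) (hy₀' : y₀ < 1)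
    (hint : x₀ + 1 < y₀)
    (ht : 0 ≤ t) (ht' : t ≤ (-x₀ + y₀ - 1) / y₀)
    (P P₁ P₂ : Set (ℝ × ℝ))
    (hP : P = uncondOf (convexHull ℝ
      {((0 : ℝ), (0 : ℝ)), (-1, 0), (x₀, y₀), (-t, 1), (0, 1)}))
    (hP₁ : P₁ = uncondOf (convexHull ℝ
      {((0 : ℝ), (0 : ℝ)), (-1, 0), (x₀, y₀), (0, 1)}))
    (hP₂ : P₂ = uncondOf (convexHull ℝ
      {((0 : ℝ), (0 : ℝ)), (-1, 0), ((x₀ + 1 - y₀) / y₀, 1), (0, 1)})) :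
    min (mahler3 (revolution P₁)) (mahler3 (revolution P₂)) ≤ mahler3 (revolution P) := by
  obtain ⟨a, rfl⟩ : ∃ a, x₀ = -a := ⟨-x₀, by ring⟩
  rw [le_div_iff₀ hy₀, neg_neg] at ht'
  have ha : 0 < a := by linarith
  have ha1 : a < 1 := by linarith
  have hab : 1 - a < y₀ := by linarith
  have htb : y₀ * t ≤ a + y₀ - 1 := by linarith
  have hc : (-a + 1 - y₀) / y₀ = -((a + y₀ - 1) / y₀) := by ring
  rw [hc, ← pentagon_of_collinear hy₀ hy₀'.le] at hP₂
  rw [← pentagon_zero] at hP₁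
  change P = uncondOf (pentagon a y₀ t) at hP
  rw [hP, hP₁, hP₂, mahler3_revolution_pentagon ha1 hy₀ hy₀' hab ht htb,
    mahler3_revolution_pentagon ha1 hy₀ hy₀' hab le_rfl (by linarith),
    mahler3_revolution_pentagon ha1 hy₀ hy₀' hab (div_nonneg (by linarith) hy₀.le)
      (by field_simp; exact le_rfl), min_le_iff]
  exact (min_endpoints_le_profileIntegral_mul ha ha1 hy₀ hy₀' hab ht htb).imp
    (fun h => ENNReal.ofReal_le_ofReal (mul_le_mul_of_nonneg_left h (by positivity)))
    (fun h => ENNReal.ofReal_le_ofReal (mul_le_mul_of_nonneg_left h (by positivity)))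
end

section
/- Let A = (-1,1), B = (0,1), D = (-1,0), O = (0,0) in ℝ². Let A₂ = (x₀,y₀) lie in the interior of the triangle ABD, let C = ((x₀ + 1 − y₀)/y₀, 1), and let A₁ = (−t, 1) with 0 ≤ t ≤ (−x₀ + y₀ − 1)/y₀. Let P be the 1-unconditional polygon with P ∩ {x ≤ 0, y ≥ 0} = conv{O, D, A₂, A₁, B}, and let R be the body of revolution about the X-axis generated by P. Then the Mahler volume satisfies P(R) ≥ 4π²/3. -/
open MeasureTheory Real Set

set_option maxHeartbeats 2000000 in
lemma pentagon_polynomial_ineq {b v s : ℝ} (hb : 0 ≤ b) (hb' : b ≤ 1) (hv : 0 ≤ v) (hv' : v ≤ 1)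
    (hs : 0 ≤ s) (hs' : s ≤ 1) :
    3 * (1 - b * v - b * s * (1 - v)) ^ 2 ≤
      (s * (1 - v) * (2 - b - b ^ 2) + (1 - b * v) * (1 + b) + b ^ 2) *
        ((1 - b) * ((1 - b * v - b * s * (1 - v)) * (1 - v ^ 2) +
            (1 - b * v - s * (1 - v)) * (1 - v)) +
          (1 - b * v - s * (1 - v)) ^ 2 +
          (1 - b * v - s * (1 - v)) * (1 - b * v - b * s * (1 - v)) * v +
          v ^ 2 * (1 - b * v - b * s * (1 - v)) ^ 2) := by
  obtain ⟨B, hB⟩ : ∃ B, B = 1 - b := ⟨_, rfl⟩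
  obtain ⟨V, hV⟩ : ∃ V, V = 1 - v := ⟨_, rfl⟩
  obtain ⟨S, hS⟩ : ∃ S, S = 1 - s := ⟨_, rfl⟩
  have hB0 : 0 ≤ B := by linarith
  have hV0 : 0 ≤ V := by linarith
  have hS0 : 0 ≤ S := by linarith
  have key : 0 ≤ V * (
      3 * B ^ 4 * V ^ 4 * s * S ^ 2 + B ^ 4 * V ^ 4 * s ^ 2 * S +
      12 * B ^ 4 * v * V ^ 3 * s * S ^ 2 + 9 * B ^ 4 * v * V ^ 3 * s ^ 2 * S +
      B ^ 4 * v * V ^ 3 * s ^ 3 + 18 * B ^ 4 * v ^ 2 * V ^ 2 * s * S ^ 2 +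
      21 * B ^ 4 * v ^ 2 * V ^ 2 * s ^ 2 * S + 5 * B ^ 4 * v ^ 2 * V ^ 2 * s ^ 3 +
      12 * B ^ 4 * v ^ 3 * V * s * S ^ 2 + 19 * B ^ 4 * v ^ 3 * V * s ^ 2 * S +
      7 * B ^ 4 * v ^ 3 * V * s ^ 3 + 3 * B ^ 4 * v ^ 4 * s * S ^ 2 +
      6 * B ^ 4 * v ^ 4 * s ^ 2 * S + 3 * B ^ 4 * v ^ 4 * s ^ 3 + b * B ^ 3 * V ^ 4 * S ^ 3 +
      11 * b * B ^ 3 * V ^ 4 * s * S ^ 2 + 3 * b * B ^ 3 * V ^ 4 * s ^ 2 * S +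
      5 * b * B ^ 3 * v * V ^ 3 * S ^ 3 + 44 * b * B ^ 3 * v * V ^ 3 * s * S ^ 2 +
      25 * b * B ^ 3 * v * V ^ 3 * s ^ 2 * S + 2 * b * B ^ 3 * v * V ^ 3 * s ^ 3 +
      10 * b * B ^ 3 * v ^ 2 * V ^ 2 * S ^ 3 + 69 * b * B ^ 3 * v ^ 2 * V ^ 2 * s * S ^ 2 +
      60 * b * B ^ 3 * v ^ 2 * V ^ 2 * s ^ 2 * S + 10 * b * B ^ 3 * v ^ 2 * V ^ 2 * s ^ 3 +
      9 * b * B ^ 3 * v ^ 3 * V * S ^ 3 + 48 * b * B ^ 3 * v ^ 3 * V * s * S ^ 2 +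
      53 * b * B ^ 3 * v ^ 3 * V * s ^ 2 * S + 14 * b * B ^ 3 * v ^ 3 * V * s ^ 3 +
      3 * b * B ^ 3 * v ^ 4 * S ^ 3 + 12 * b * B ^ 3 * v ^ 4 * s * S ^ 2 +
      15 * b * B ^ 3 * v ^ 4 * s ^ 2 * S + 6 * b * B ^ 3 * v ^ 4 * s ^ 3 +
      4 * b ^ 2 * B ^ 2 * V ^ 4 * S ^ 3 + 15 * b ^ 2 * B ^ 2 * V ^ 4 * s * S ^ 2 +
      3 * b ^ 2 * B ^ 2 * V ^ 4 * s ^ 2 * S + 18 * b ^ 2 * B ^ 2 * v * V ^ 3 * S ^ 3 +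
      61 * b ^ 2 * B ^ 2 * v * V ^ 3 * s * S ^ 2 + 23 * b ^ 2 * B ^ 2 * v * V ^ 3 * s ^ 2 * S +
      b ^ 2 * B ^ 2 * v * V ^ 3 * s ^ 3 + 32 * b ^ 2 * B ^ 2 * v ^ 2 * V ^ 2 * S ^ 3 +
      99 * b ^ 2 * B ^ 2 * v ^ 2 * V ^ 2 * s * S ^ 2 +
      57 * b ^ 2 * B ^ 2 * v ^ 2 * V ^ 2 * s ^ 2 * S + 5 * b ^ 2 * B ^ 2 * v ^ 2 * V ^ 2 * s ^ 3 +
      24 * b ^ 2 * B ^ 2 * v ^ 3 * V * S ^ 3 + 66 * b ^ 2 * B ^ 2 * v ^ 3 * V * s * S ^ 2 +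
      49 * b ^ 2 * B ^ 2 * v ^ 3 * V * s ^ 2 * S + 7 * b ^ 2 * B ^ 2 * v ^ 3 * V * s ^ 3 +
      6 * b ^ 2 * B ^ 2 * v ^ 4 * S ^ 3 + 15 * b ^ 2 * B ^ 2 * v ^ 4 * s * S ^ 2 +
      12 * b ^ 2 * B ^ 2 * v ^ 4 * s ^ 2 * S + 3 * b ^ 2 * B ^ 2 * v ^ 4 * s ^ 3 +
      3 * b ^ 3 * B * V ^ 4 * S ^ 3 + 6 * b ^ 3 * B * V ^ 4 * s * S ^ 2 +
      12 * b ^ 3 * B * v * V ^ 3 * S ^ 3 + 23 * b ^ 3 * B * v * V ^ 3 * s * S ^ 2 +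
      2 * b ^ 3 * B * v * V ^ 3 * s ^ 2 * S + 19 * b ^ 3 * B * v ^ 2 * V ^ 2 * S ^ 3 +
      36 * b ^ 3 * B * v ^ 2 * V ^ 2 * s * S ^ 2 + 8 * b ^ 3 * B * v ^ 2 * V ^ 2 * s ^ 2 * S +
      9 * b ^ 3 * B * v ^ 3 * V * S ^ 3 + 15 * b ^ 3 * B * v ^ 3 * V * s * S ^ 2 +
      6 * b ^ 3 * B * v ^ 3 * V * s ^ 2 * S + b ^ 4 * v * V ^ 3 * S ^ 3 +
      b ^ 4 * v * V ^ 3 * s * S ^ 2 + 3 * b ^ 4 * v ^ 2 * V ^ 2 * S ^ 3 +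
      3 * b ^ 4 * v ^ 2 * V ^ 2 * s * S ^ 2
      ) := by positivity
  subst hB hV hS
  linear_combination key

lemma volume_disc {r : ℝ} (hr : 0 ≤ r) :
    volume {p : ℝ × ℝ | √(p.1 ^ 2 + p.2 ^ 2) ≤ r} = ENNReal.ofReal (π * r ^ 2) := by
  have hm : MeasurableSet {p : ℝ × ℝ | √(p.1 ^ 2 + p.2 ^ 2) ≤ r} :=
    (isClosed_le (by fun_prop) continuous_const).measurableSet
  have h := Complex.volume_preserving_equiv_real_prod.measure_preimage hm.nullMeasurableSet
  have h2 : Complex.measurableEquivRealProd ⁻¹' {p : ℝ × ℝ | √(p.1 ^ 2 + p.2 ^ 2) ≤ r} =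
      Metric.closedBall 0 r := by
    ext z
    simp [Complex.norm_eq_sqrt_sq_add_sq]
  rw [← h, h2, Complex.volume_closedBall, mul_comm π, ENNReal.ofReal_mul (by positivity),
    ENNReal.ofReal_pow hr]
  congr 1
  rw [ENNReal.ofReal, Real.toNNReal_of_nonneg pi_pos.le]
  rfl

lemma integral_affine_sq {p q r s : ℝ} (hpq : p < q) :
    ∫ x in p..q, (r + (s - r) * ((x - p) / (q - p))) ^ 2 =
      (q - p) * (r ^ 2 + r * s + s ^ 2) / 3 := by
  have hne : q - p ≠ 0 := by linarith
  have hd : ∀ x ∈ uIcc p q, HasDerivAt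
      (fun x ↦ (q - p) * (r ^ 2 * ((x - p) / (q - p)) + r * (s - r) * ((x - p) / (q - p)) ^ 2 +
        (s - r) ^ 2 * ((x - p) / (q - p)) ^ 3 / 3))
      ((r + (s - r) * ((x - p) / (q - p))) ^ 2) x := by
    intro x _
    have h1 : HasDerivAt (fun x ↦ (x - p) / (q - p)) (1 / (q - p)) x :=
      ((hasDerivAt_id x).sub_const p).div_const _
    refine ((((h1.const_mul (r ^ 2)).add ((h1.pow 2).const_mul (r * (s - r)))).add
      (((h1.pow 3).const_mul ((s - r) ^ 2)).div_const 3)).const_mul (q - p)).congr_deriv ?_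
    generalize (x - p) / (q - p) = m
    push_cast
    field_simp
    ring
  rw [intervalIntegral.integral_eq_sub_of_hasDerivAt hd
    (Continuous.intervalIntegrable (by fun_prop) _ _)]
  field_simp
  ring

/-- If the planar set `D` contains the part of the half plane below the segment from `(p, r)` to
`(q, s)`, then its body of revolution has at least the volume of the frustum over `(p, q)`. -/
lemma le_volume_revolution_inter {D : Set (ℝ × ℝ)} {p q r s : ℝ} (hpq : p ≤ q)
    (hr : 0 ≤ r) (hs : 0 ≤ s)
    (hD : ∀ c ∈ Icc (0 : ℝ) 1, ∀ y, 0 ≤ y → y ≤ r + (s - r) * c → (p + c * (q - p), y) ∈ D) :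
    ENNReal.ofReal (π * ((q - p) * (r ^ 2 + r * s + s ^ 2) / 3)) ≤
      volume (revolution D ∩ {x | x.1 ∈ Ioo p q}) := by
  rcases hpq.eq_or_lt with rfl | hpq
  · simp
  have hne : 0 < q - p := by linarith
  set l : ℝ → ℝ := fun x ↦ r + (s - r) * ((x - p) / (q - p)) with hl
  have hlc : Continuous l := by fun_prop
  have hc : ∀ x ∈ Ioo p q, (x - p) / (q - p) ∈ Icc (0 : ℝ) 1 := fun x hx ↦
    ⟨div_nonneg (by linarith [hx.1]) hne.le, (div_le_one hne).2 (by linarith [hx.2])⟩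
  have hl0 : ∀ x ∈ Ioo p q, 0 ≤ l x := by
    intro x hx
    obtain ⟨h0, h1⟩ := hc x hx
    have : l x = (1 - (x - p) / (q - p)) * r + (x - p) / (q - p) * s := by simp only [hl]; ring
    rw [this]
    exact add_nonneg (mul_nonneg (by linarith) hr) (mul_nonneg h0 hs)
  set T : Set (ℝ × ℝ × ℝ) := {x | x.1 ∈ Ioo p q ∧ √(x.2.1 ^ 2 + x.2.2 ^ 2) ≤ l x.1} with hT
  have hTm : MeasurableSet T :=
    (measurable_fst measurableSet_Ioo).inter
      (isClosed_le (by fun_prop) (hlc.comp continuous_fst)).measurableSet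
  have hTS : T ⊆ revolution D ∩ {x | x.1 ∈ Ioo p q} := by
    rintro ⟨x, y, z⟩ ⟨hx, hyz⟩
    refine ⟨?_, hx⟩
    have := hD _ (hc x hx) _ (Real.sqrt_nonneg _) hyz
    rwa [div_mul_cancel₀ _ hne.ne', add_sub_cancel] at this
  refine le_trans (le_of_eq ?_) (measure_mono hTS)
  have hslice : ∀ x, volume (Prod.mk x ⁻¹' T) =
      (Ioo p q).indicator (fun x ↦ ENNReal.ofReal (π * l x ^ 2)) x := by
    intro x
    by_cases hx : x ∈ Ioo p q
    · rw [indicator_of_mem hx, ← volume_disc (hl0 x hx)]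
      congr 1
      ext y
      exact and_iff_right hx
    · rw [indicator_of_notMem hx]
      convert measure_empty (μ := (volume : Measure (ℝ × ℝ)))
      ext y
      exact iff_of_false (fun h ↦ hx h.1) (notMem_empty _)
  rw [Measure.volume_eq_prod, Measure.prod_apply hTm]
  simp_rw [hslice]
  rw [lintegral_indicator measurableSet_Ioo, ← ofReal_integral_eq_lintegral_ofReal,
    ← integral_Ioc_eq_integral_Ioo, ← intervalIntegral.integral_of_le hpq.le,
    intervalIntegral.integral_const_mul, integral_affine_sq hpq]
  · exact ((Continuous.integrableOn_Icc (a := p) (b := q) (by fun_prop)).mono_set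
      Ioo_subset_Icc_self)
  · exact Filter.Eventually.of_forall fun x ↦ by positivity

lemma add_le_measure_inter_union {α : Type*} [MeasurableSpace α] {μ : Measure α} {S A B : Set α}
    {x y : ENNReal} (hA : MeasurableSet A) (hAB : Disjoint A B) (hx : x ≤ μ (S ∩ A))
    (hy : y ≤ μ (S ∩ B)) : x + y ≤ μ (S ∩ (A ∪ B)) := by
  rw [← measure_inter_add_sdiff (S ∩ (A ∪ B)) hA]
  refine add_le_add (hx.trans (measure_mono ?_)) (hy.trans (measure_mono ?_))
  · exact fun z hz ↦ ⟨⟨hz.1, Or.inl hz.2⟩, hz.2⟩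
  · exact fun z hz ↦ ⟨⟨hz.1, Or.inr hz.2⟩, fun h ↦ hAB.le_bot ⟨h, hz.2⟩⟩

/-- The two-sided version of `le_volume_revolution_inter`. -/
lemma le_volume_revolution_inter_abs {D : Set (ℝ × ℝ)} {p q r s : ℝ} (hp : 0 ≤ p) (hpq : p ≤ q)
    (hr : 0 ≤ r) (hs : 0 ≤ s)
    (hD : ∀ x y, ∀ c ∈ Icc (0 : ℝ) 1, |x| = p + c * (q - p) → 0 ≤ y → y ≤ r + (s - r) * c →
      (x, y) ∈ D) :
    ENNReal.ofReal (π * (2 * (q - p) * (r ^ 2 + r * s + s ^ 2) / 3)) ≤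
      volume (revolution D ∩ {x | |x.1| ∈ Ioo p q}) := by
  have h1 := le_volume_revolution_inter (D := D) hpq hr hs (fun c hc y hy hy' ↦
    hD _ y c hc (abs_of_nonneg (by nlinarith [mul_nonneg hc.1 (sub_nonneg.2 hpq)])) hy hy')
  have h2 := le_volume_revolution_inter (D := D) (neg_le_neg hpq) hs hr (fun c hc y hy hy' ↦ by
    have hc' : (1 - c) ∈ Icc (0 : ℝ) 1 := ⟨by linarith [hc.2], by linarith [hc.1]⟩
    refine hD _ y (1 - c) hc' ?_ hy (by linarith)
    rw [abs_of_nonpos]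
    · ring
    · nlinarith [mul_nonneg hc'.1 (sub_nonneg.2 hpq)])
  have hdisj : Disjoint {x : ℝ × ℝ × ℝ | x.1 ∈ Ioo p q} {x | x.1 ∈ Ioo (-q) (-p)} := by
    refine Set.disjoint_left.2 fun x hx hx' ↦ ?_
    have := hx.1
    have := hx'.2
    linarith
  have h3 := add_le_measure_inter_union (measurable_fst measurableSet_Ioo) hdisj h1 h2
  rw [← ENNReal.ofReal_add] at h3
  · refine le_trans (le_of_eq (by congr 1; ring)) (h3.trans (measure_mono ?_))
    rintro x ⟨hx, hx' | hx'⟩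
    · refine ⟨hx, ?_⟩
      have h0 : 0 < x.1 := hp.trans_lt hx'.1
      simpa [abs_of_pos h0] using hx'
    · refine ⟨hx, ?_⟩
      have h0 : x.1 < 0 := by linarith [hx'.2]
      have h4 := hx'.1
      have h5 := hx'.2
      simp only [mem_ofPred_eq, abs_of_neg h0]
      exact ⟨by linarith, by linarith⟩
  · have : 0 ≤ q - p := by linarith
    positivity
  · have : 0 ≤ -p - -q := by linarith
    positivity

lemma measurableSet_abs_fst_mem_Ioo (p q : ℝ) :
    MeasurableSet {x : ℝ × ℝ × ℝ | |x.1| ∈ Ioo p q} :=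
  (measurable_fst.abs) measurableSet_Ioo

lemma disjoint_abs_fst_mem_Ioo {p q p' q' : ℝ} (h : q ≤ p') :
    Disjoint {x : ℝ × ℝ × ℝ | |x.1| ∈ Ioo p q} {x | |x.1| ∈ Ioo p' q'} :=
  Set.disjoint_left.2 fun _ hx hx' ↦ lt_irrefl _ (hx.2.trans_le (h.trans hx'.1.le))

/-- Volume of the body of revolution generated by the pentagon. -/
lemma le_volume_revolution_pentagon {a b t : ℝ} (ht : 0 ≤ t) (hta : t ≤ a) (ha : a ≤ 1)
    (hb : 0 ≤ b) :
    ENNReal.ofReal (2 * π / 3 * (t * (2 - b - b ^ 2) + a * (1 + b) + b ^ 2)) ≤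
      volume (revolution (uncondOf (convexHull ℝ
        {((0 : ℝ), (0 : ℝ)), (-1, 0), (-a, b), (-t, 1), (0, 1)}))) := by
  set H := convexHull ℝ {((0 : ℝ), (0 : ℝ)), (-1, 0), (-a, b), (-t, 1), (0, 1)} with hH
  have hconv : Convex ℝ H := convex_convexHull _ _
  have hO : ((0 : ℝ), (0 : ℝ)) ∈ H := subset_convexHull _ _ (by simp)
  have hD : ((-1 : ℝ), (0 : ℝ)) ∈ H := subset_convexHull _ _ (by simp)
  have hA2 : (-a, b) ∈ H := subset_convexHull _ _ (by simp)
  have hA1 : (-t, (1 : ℝ)) ∈ H := subset_convexHull _ _ (by simp)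
  have hB : ((0 : ℝ), (1 : ℝ)) ∈ H := subset_convexHull _ _ (by simp)
  have hbase : ∀ x ∈ Icc (0 : ℝ) 1, (-x, (0 : ℝ)) ∈ H := by
    intro x hx
    have := hconv hO hD (sub_nonneg.2 hx.2) hx.1 (by ring)
    simpa using this
  have key : ∀ p q r s : ℝ, 0 ≤ p → p ≤ q → q ≤ 1 → 0 ≤ r → 0 ≤ s → (-p, r) ∈ H → (-q, s) ∈ H →
      ENNReal.ofReal (π * (2 * (q - p) * (r ^ 2 + r * s + s ^ 2) / 3)) ≤
      volume (revolution (uncondOf H) ∩ {x | |x.1| ∈ Ioo p q}) := by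
    intro p q r s hp hpq hq hr hs hpr hqs
    refine le_volume_revolution_inter_abs hp hpq hr hs fun x y c hc hx hy hyl ↦ ?_
    have hc1 : 0 ≤ 1 - c := sub_nonneg.2 hc.2
    have htop : (-|x|, r + (s - r) * c) ∈ H := by
      have := hconv hpr hqs hc1 hc.1 (by ring)
      convert this using 1
      ext
      · simp [hx]; ring
      · simp; ring
    have hx1 : |x| ≤ 1 := by
      rw [hx]
      nlinarith [mul_nonneg hc1 (sub_nonneg.2 hpq)]
    have hbot := hbase |x| ⟨abs_nonneg x, hx1⟩
    change (-|x|, |y|) ∈ H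
    rw [abs_of_nonneg hy]
    rcases (hy.trans hyl).eq_or_lt with h0 | h0
    · rwa [le_antisymm (hyl.trans h0.symm.le) hy]
    · have := hconv hbot htop (sub_nonneg.2 ((div_le_one h0).2 hyl)) (div_nonneg hy h0.le)
        (by ring)
      convert this using 1
      ext
      · simp; ring
      · simp [div_mul_cancel₀ _ h0.ne']
  have h1 := key 0 t 1 1 le_rfl ht (hta.trans ha) zero_le_one zero_le_one (by simpa using hB) hA1
  have h2 := key t a 1 b ht hta ha zero_le_one hb hA1 hA2
  have h3 := key a 1 b 0 (ht.trans hta) ha le_rfl hb le_rfl hA2 hD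
  have h12 := add_le_measure_inter_union (measurableSet_abs_fst_mem_Ioo _ _)
    (disjoint_abs_fst_mem_Ioo le_rfl) h1 h2
  have h123 := add_le_measure_inter_union ((measurableSet_abs_fst_mem_Ioo _ _).union
    (measurableSet_abs_fst_mem_Ioo _ _))
    ((disjoint_abs_fst_mem_Ioo hta).union_left (disjoint_abs_fst_mem_Ioo le_rfl)) h12 h3
  refine le_trans (le_of_eq ?_) (h123.trans (measure_mono inter_subset_left))
  have : 0 ≤ t - 0 := by linarith
  have : 0 ≤ a - t := by linarith
  have : 0 ≤ 1 - a := by linarith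
  rw [← ENNReal.ofReal_add (by positivity) (by positivity),
    ← ENNReal.ofReal_add (by positivity) (by positivity)]
  congr 1
  ring

lemma revolution_subset_polar3 {a b t : ℝ} (ht : 0 ≤ t) :
    revolution {p | |p.1| ≤ 1 ∧ a * |p.1| + b * |p.2| ≤ 1 ∧ t * |p.1| + |p.2| ≤ 1} ⊆
      polar3 (revolution (uncondOf (convexHull ℝ
        {((0 : ℝ), (0 : ℝ)), (-1, 0), (-a, b), (-t, 1), (0, 1)}))) := by
  rintro ⟨u, v, w⟩ ⟨h1, h2, h3⟩ ⟨x, y, z⟩ hx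
  simp only [abs_of_nonneg (Real.sqrt_nonneg _)] at h1 h2 h3
  set ρ := √(v ^ 2 + w ^ 2) with hρ
  have hρ0 : 0 ≤ ρ := Real.sqrt_nonneg _
  change (-|x|, |√(y ^ 2 + z ^ 2)|) ∈ convexHull ℝ _ at hx
  rw [abs_of_nonneg (Real.sqrt_nonneg _)] at hx
  have hlin : IsLinearMap ℝ (fun p : ℝ × ℝ ↦ -|u| * p.1 + ρ * p.2) :=
    ⟨fun p q ↦ by simp; ring, fun c p ↦ by simp; ring⟩
  have hsub := convexHull_min (s := {((0 : ℝ), (0 : ℝ)), (-1, 0), (-a, b), (-t, 1), (0, 1)})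
    (t := {p : ℝ × ℝ | -|u| * p.1 + ρ * p.2 ≤ 1}) (by
      have := mul_nonneg ht (abs_nonneg u)
      rintro p (rfl | rfl | rfl | rfl | rfl) <;> simp only [mem_ofPred_eq] <;> linarith)
    (convex_halfSpace_le hlin 1) hx
  simp only [mem_ofPred_eq] at hsub
  have hxu : u * x ≤ |u| * |x| := (le_abs_self _).trans (abs_mul u x).le
  have hyz : v * y + w * z ≤ ρ * √(y ^ 2 + z ^ 2) := by
    rw [hρ, ← Real.sqrt_mul (by positivity)]
    refine Real.le_sqrt_of_sq_le ?_
    nlinarith [sq_nonneg (v * z - w * y)]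
  simp only [dot3]
  linarith

/-- Volume of the polar of the body of revolution generated by the pentagon; `(u, k)` and `(1, v)`
are vertices of the polar polygon. -/
lemma le_volume_polar3_revolution_pentagon {a b t u k v : ℝ} (ht : 0 ≤ t)
    (hb : 0 ≤ b) (hu : 0 ≤ u) (hu1 : u ≤ 1) (hk : 0 ≤ k) (hv : 0 ≤ v) (hb1 : b ≤ 1)
    (hau : a * u + b * k ≤ 1) (hav : a + b * v ≤ 1) (htu : t * u + k ≤ 1) (htv : t + v ≤ 1) :
    ENNReal.ofReal (2 * π / 3 * (u * (1 + k + k ^ 2) + (1 - u) * (k ^ 2 + k * v + v ^ 2))) ≤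
      volume (polar3 (revolution (uncondOf (convexHull ℝ
        {((0 : ℝ), (0 : ℝ)), (-1, 0), (-a, b), (-t, 1), (0, 1)})))) := by
  have key : ∀ p q r s : ℝ, 0 ≤ p → p ≤ q → q ≤ 1 → 0 ≤ r → 0 ≤ s → a * p + b * r ≤ 1 →
      a * q + b * s ≤ 1 → t * p + r ≤ 1 → t * q + s ≤ 1 →
      ENNReal.ofReal (π * (2 * (q - p) * (r ^ 2 + r * s + s ^ 2) / 3)) ≤
      volume (revolution {p | |p.1| ≤ 1 ∧ a * |p.1| + b * |p.2| ≤ 1 ∧ t * |p.1| + |p.2| ≤ 1} ∩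
        {x | |x.1| ∈ Ioo p q}) := by
    intro p q r s hp hpq hq hr hs h1 h2 h3 h4
    refine le_volume_revolution_inter_abs hp hpq hr hs fun x y c hc hx hy hyl ↦ ?_
    have hc1 : 0 ≤ 1 - c := sub_nonneg.2 hc.2
    simp only [mem_ofPred_eq, hx, abs_of_nonneg hy]
    refine ⟨?_, ?_, ?_⟩
    · nlinarith [mul_nonneg hc1 (sub_nonneg.2 hpq)]
    · have := mul_le_mul_of_nonneg_left hyl hb
      have := mul_le_mul_of_nonneg_left h1 hc1
      have := mul_le_mul_of_nonneg_left h2 hc.1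
      linarith
    · have := mul_le_mul_of_nonneg_left h3 hc1
      have := mul_le_mul_of_nonneg_left h4 hc.1
      linarith
  have h1 := key 0 u 1 k le_rfl hu hu1 zero_le_one hk (by linarith) hau (by linarith) htu
  have h2 := key u 1 k v hu hu1 le_rfl hk hv hau (by linarith) htu (by linarith)
  have h12 := add_le_measure_inter_union (measurableSet_abs_fst_mem_Ioo _ _)
    (disjoint_abs_fst_mem_Ioo le_rfl) h1 h2
  refine le_trans (le_of_eq ?_) (h12.trans
    (measure_mono (inter_subset_left.trans (revolution_subset_polar3 ht))))
  have : 0 ≤ u - 0 := by linarith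
  have : 0 ≤ 1 - u := by linarith
  rw [← ENNReal.ofReal_add (by positivity) (by positivity)]
  congr 1
  ring

/-- Inequality (3.5) of the paper: for the 1-unconditional pentagon `P` with
quadrant part `conv{O,D,A₂,A₁,B}` (where `A₂ = (x₀,y₀)` is interior to triangle
`ABD` and `A₁ = (-t,1)`), the body of revolution generated by `P` has Mahler
volume at least `4π²/3`. -/
theorem mahler_pentagon_lower_bound (x₀ y₀ t : ℝ)
    (hx₀ : -1 < x₀) (hx₀' : x₀ < 0) (hy₀ : 0 < y₀) (hy₀' : y₀ < 1)
    (hint : x₀ + 1 < y₀)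
    (ht : 0 ≤ t) (ht' : t ≤ (-x₀ + y₀ - 1) / y₀)
    (P : Set (ℝ × ℝ))
    (hP : P = uncondOf (convexHull ℝ
      {((0 : ℝ), (0 : ℝ)), (-1, 0), (x₀, y₀), (-t, 1), (0, 1)})) :
    ENNReal.ofReal (4 * Real.pi ^ 2 / 3) ≤ mahler3 (revolution P) := by
  obtain ⟨v, hv⟩ : ∃ v, v = (1 + x₀) / y₀ := ⟨_, rfl⟩
  have hv0 : 0 < v := hv ▸ div_pos (by linarith) hy₀
  have hv1 : v < 1 := by rw [hv, div_lt_one hy₀]; linarith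
  obtain rfl : x₀ = -(1 - y₀ * v) := by rw [hv]; field_simp; ring
  have hyv : y₀ * v < y₀ := by nlinarith
  have ht1 : t ≤ 1 - v := by
    refine ht'.trans (le_of_eq ?_)
    field_simp
    ring
  obtain ⟨s, hs⟩ : ∃ s, s = t / (1 - v) := ⟨_, rfl⟩
  have hs0 : 0 ≤ s := hs ▸ div_nonneg ht (by linarith)
  have hs1 : s ≤ 1 := by rw [hs, div_le_one (by linarith)]; exact ht1
  have hts : t = s * (1 - v) := by rw [hs, div_mul_cancel₀ _ (by linarith)]
  have hpoly := pentagon_polynomial_ineq hy₀.le hy₀'.le hv0.le hv1.le hs0 hs1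
  have hbs : y₀ * s * (1 - v) = y₀ * t := by rw [hts]; ring
  rw [hbs, ← hts] at hpoly
  obtain ⟨w, hw⟩ : ∃ w, w = 1 - y₀ * v - y₀ * t := ⟨_, rfl⟩
  have hw1 : 1 - y₀ ≤ w := by
    have := mul_le_mul_of_nonneg_left ht1 hy₀.le
    linarith
  have hw0 : 0 < w := by linarith
  have hn0 : 0 ≤ 1 - y₀ * v - t := by
    have : 0 ≤ (1 - y₀) * v := mul_nonneg (by linarith) hv0.le
    linarith
  have hF := le_volume_revolution_pentagon (a := 1 - y₀ * v) (b := y₀) ht (by linarith)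
    (by nlinarith) hy₀.le
  have hG := le_volume_polar3_revolution_pentagon (a := 1 - y₀ * v) (b := y₀) (t := t)
    (u := (1 - y₀) / w) (k := (1 - y₀ * v - t) / w) (v := v) ht hy₀.le
    (div_nonneg (by linarith) hw0.le) ((div_le_one hw0).2 hw1) (div_nonneg hn0 hw0.le) hv0.le
    hy₀'.le (by
      refine le_of_eq ?_
      field_simp
      rw [hw]
      ring) (by linarith) (by
      refine le_of_eq ?_
      field_simp
      rw [hw]
      ring) (by linarith)
  rw [hP, mahler3]
  refine le_trans ?_ (mul_le_mul' hF hG)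
  have hF0 : 0 ≤ t * (2 - y₀ - y₀ ^ 2) + (1 - y₀ * v) * (1 + y₀) + y₀ ^ 2 := by
    have h1 : 0 ≤ 2 - y₀ - y₀ ^ 2 := by nlinarith
    have h2 : 0 ≤ 1 - y₀ * v := by linarith
    positivity
  rw [← ENNReal.ofReal_mul (by positivity)]
  refine ENNReal.ofReal_le_ofReal ?_
  have hmain : 3 ≤ (t * (2 - y₀ - y₀ ^ 2) + (1 - y₀ * v) * (1 + y₀) + y₀ ^ 2) *
      ((1 - y₀) / w * (1 + (1 - y₀ * v - t) / w + ((1 - y₀ * v - t) / w) ^ 2) +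
        (1 - (1 - y₀) / w) * (((1 - y₀ * v - t) / w) ^ 2 + (1 - y₀ * v - t) / w * v + v ^ 2)) := by
    rw [← hw] at hpoly
    rw [← le_div_iff₀ (by positivity)] at hpoly
    refine hpoly.trans (le_of_eq ?_)
    rw [mul_div_assoc]
    congr 1
    field_simp
    ring
  have := mul_le_mul_of_nonneg_left hmain (show 0 ≤ 4 * π ^ 2 / 9 by positivity)
  linarith
end

section
/- Let A = (-1,1), B = (0,1), D = (-1,0), O = (0,0) in ℝ², let n ≥ 3, and let A₁, A₂, …, A_{n-1} be points with A₁ = (−t,1) on the segment AB (t ≥ 0), A₂, …, A_{n-1} in the interior of the triangle ABD, such that the slopes of the lines OA_i are strictly increasing in i and the points A₁, …, A_{n-1}, D are in convex position, i.e. the set conv{A₁, …, A_{n-1}, D, O, B} has all the A_i as vertices. Let P be the 1-unconditional polygon with P ∩ {x ≤ 0, y ≥ 0} = conv{A₁, A₂, …, A_{n-1}, D, O, B}, and let R be the body of revolution about the X-axis generated by P. Let C be the intersection of the line through A₂ and A₃ with the line y = 1 (for n = 3 take A₃ = D), and let R₁ and R₂ be the bodies of revolution generated by the 1-unconditional polygons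 P₁, P₂ with P₁ ∩ {x ≤ 0, y ≥ 0} = conv{A₂, A₃, …, A_{n-1}, D, O, B} and P₂ ∩ {x ≤ 0, y ≥ 0} = conv{C, A₃, …, A_{n-1}, D, O, B}. Then P(R) ≥ min{P(R₁), P(R₂)}, where P(·) denotes the Mahler volume. -/
open MeasureTheory Real Set

theorem weighted_cap_convexity {a y s c κ w : ℝ} (ha : 0 < a) (hy : 0 < y) (hy1 : y < 1) (hs : 0 < s)
    (hsc : s ≤ c) (hca : c ≤ a) (hκ : 0 < κ) (hw0 : 0 ≤ w) (hw : w ≤ κ * (3 - 2 * y)) (g : ℝ → ℝ)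
    (hg : ∀ x, g x = (1 - y) ^ 2 * x * (3 * a - x * (1 + 2 * y)) / (a - x * y) ^ 2) :
    c * w * (w - κ * g c) ≤ (w - κ * g s) * ((c - s) * (w - κ * g c) + s * w) := by
  have hc : 0 < c := hs.trans_le hsc
  have hDs : 0 < a - s * y := by nlinarith
  have hDc : 0 < a - c * y := by nlinarith
  have hNs : 0 < 3 * a - s * (1 + 2 * y) := by nlinarith
  have hNc : 0 < 3 * a - c * (1 + 2 * y) := by nlinarith
  have key : (3 - 2 * y) * ((1 + 2 * y) * a ^ 2 - 6 * a ^ 2 * y + 3 * a * y ^ 2 * (c + s)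
      - (1 + 2 * y) * s * c * y ^ 2)
      ≤ (1 - y) ^ 2 * ((3 * a - s * (1 + 2 * y)) * (3 * a - c * (1 + 2 * y))) := by
    have h00 : 0 ≤ (a - s) * (a - c) * (6 - 4 * y + y ^ 2) := by
      apply mul_nonneg (mul_nonneg (by linarith) (by linarith)); nlinarith
    have h10 : 0 ≤ (s * (a - c) + c * (a - s)) * ((1 - y) * (3 - y)) := by
      apply mul_nonneg (add_nonneg (mul_nonneg hs.le (by linarith))
        (mul_nonneg hc.le (by linarith))) (mul_nonneg (by linarith) (by linarith))
    have h11 : 0 ≤ s * c * ((1 - y) ^ 2) := by positivity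
    nlinarith
  have hmain : (3 - 2 * y) * (c * g s - s * g c) ≤ (c - s) * (g s * g c) := by
    have e1 : (c - s) * (g s * g c) - (3 - 2 * y) * (c * g s - s * g c) =
        (1 - y) ^ 2 * s * c * (c - s) / ((a - s * y) ^ 2 * (a - c * y) ^ 2) *
        ((1 - y) ^ 2 * ((3 * a - s * (1 + 2 * y)) * (3 * a - c * (1 + 2 * y))) -
        (3 - 2 * y) * ((1 + 2 * y) * a ^ 2 - 6 * a ^ 2 * y + 3 * a * y ^ 2 * (c + s)
      - (1 + 2 * y) * s * c * y ^ 2)) := by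
      rw [hg, hg]
      field_simp
      ring
    have : 0 ≤ (1 - y) ^ 2 * s * c * (c - s) / ((a - s * y) ^ 2 * (a - c * y) ^ 2) := by
      have : 0 ≤ c - s := by linarith
      positivity
    have := mul_nonneg this (sub_nonneg.2 key)
    linarith
  have hgs : 0 ≤ g s := by rw [hg]; positivity
  have hgc : 0 ≤ g c := by rw [hg]; positivity
  have hid : (w - κ * g s) * ((c - s) * (w - κ * g c) + s * w) - c * w * (w - κ * g c)
      = κ * (κ * ((c - s) * (g s * g c)) - w * (c * g s - s * g c)) := by ring
  have : w * (c * g s - s * g c) ≤ κ * ((c - s) * (g s * g c)) := by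
    rcases le_total (c * g s - s * g c) 0 with h | h
    · have h1 := mul_nonpos_of_nonneg_of_nonpos hw0 h
      have : 0 ≤ κ * ((c - s) * (g s * g c)) := by
        have : 0 ≤ c - s := by linarith
        positivity
      linarith
    · calc _ ≤ κ * (3 - 2 * y) * (c * g s - s * g c) := mul_le_mul_of_nonneg_right hw h
        _ = κ * ((3 - 2 * y) * (c * g s - s * g c)) := by ring
        _ ≤ _ := mul_le_mul_of_nonneg_left hmain hκ.le
  have := mul_nonneg hκ.le (sub_nonneg.2 this)
  linarith

theorem volume_revolution {S : Set (ℝ × ℝ)} (hS : MeasurableSet S) :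
    volume (revolution S) = ENNReal.ofReal (2 * π) *
      ∫⁻ r in Ioi (0 : ℝ), ENNReal.ofReal r * volume {x : ℝ | (x, r) ∈ S} := by
  have hm : Measurable fun r : ℝ => volume {x : ℝ | (x, r) ∈ S} :=
    measurable_measure_prodMk_right hS
  have hR : MeasurableSet (revolution S) := by
    refine hS.preimage (f := fun p : ℝ × ℝ × ℝ => (p.1, √(p.2.1 ^ 2 + p.2.2 ^ 2))) ?_
    fun_prop
  rw [Measure.volume_eq_prod, Measure.prod_apply_symm hR]
  have hm2 : Measurable fun r : ℝ => ENNReal.ofReal r * volume {x : ℝ | (x, r) ∈ S} :=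
    ENNReal.measurable_ofReal.mul hm
  have h1 : ∀ q : ℝ × ℝ, volume ((fun x => (x, q)) ⁻¹' revolution S)
      = (fun q : ℝ × ℝ => volume {x : ℝ | (x, √(q.1 ^ 2 + q.2 ^ 2)) ∈ S}) q := fun q => rfl
  simp_rw [h1]
  rw [← lintegral_comp_polarCoord_symm, polarCoord_target]
  have h2 : ∀ p ∈ Ioi (0 : ℝ) ×ˢ Ioo (-π) π,
      ENNReal.ofReal p.1 • volume {x : ℝ | (x, √((polarCoord.symm p).1 ^ 2
        + (polarCoord.symm p).2 ^ 2)) ∈ S} = ENNReal.ofReal p.1 * volume {x : ℝ | (x, p.1) ∈ S} := by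
    rintro ⟨r, θ⟩ ⟨hr, -⟩
    have : √((r * cos θ) ^ 2 + (r * sin θ) ^ 2) = r := by
      rw [show (r * cos θ) ^ 2 + (r * sin θ) ^ 2 = r ^ 2 * (sin θ ^ 2 + cos θ ^ 2) by ring,
        sin_sq_add_cos_sq, mul_one, sqrt_sq (le_of_lt hr)]
    simp only [polarCoord_symm_apply, this, smul_eq_mul]
  rw [setLIntegral_congr_fun (measurableSet_Ioi.prod measurableSet_Ioo) h2,
    Measure.volume_eq_prod, ← Measure.prod_restrict, lintegral_prod
      (fun p : ℝ × ℝ => ENNReal.ofReal p.1 * volume {x : ℝ | (x, p.1) ∈ S})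
      (hm2.comp measurable_fst).aemeasurable]
  simp only [lintegral_const, Measure.restrict_apply_univ, Real.volume_Ioo]
  rw [lintegral_mul_const _ (by fun_prop), mul_comm]
  congr 2
  ring

/-- The part of `{a|u| + yv ≤ 1, v ≤ 1}` strictly above the two lines `±su + v = 1`. -/
def cap (a y s : ℝ) : Set (ℝ × ℝ) :=
  {z | a * |z.1| + y * z.2 ≤ 1 ∧ z.2 ≤ 1 ∧ 1 < s * |z.1| + z.2}

theorem measurableSet_cap (a y s : ℝ) : MeasurableSet (cap a y s) := by
  have h1 : IsClosed {z : ℝ × ℝ | a * |z.1| + y * z.2 ≤ 1} := isClosed_le (by fun_prop) (by fun_prop)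
  have h2 : IsClosed {z : ℝ × ℝ | z.2 ≤ 1} := isClosed_le (by fun_prop) (by fun_prop)
  have h3 : IsOpen {z : ℝ × ℝ | 1 < s * |z.1| + z.2} := isOpen_lt (by fun_prop) (by fun_prop)
  exact h1.measurableSet.inter (h2.measurableSet.inter h3.measurableSet)

theorem volume_revolution_trapezoid_le {a y : ℝ} (ha : 0 < a) (hy1 : y < 1) :
    volume (revolution {z | a * |z.1| + y * z.2 ≤ 1 ∧ z.2 ≤ 1}) ≤
      ENNReal.ofReal (2 * π / (3 * a) * (3 - 2 * y)) := by
  have hm : MeasurableSet {z : ℝ × ℝ | a * |z.1| + y * z.2 ≤ 1 ∧ z.2 ≤ 1} := by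
    have h1 : IsClosed {z : ℝ × ℝ | a * |z.1| + y * z.2 ≤ 1} :=
      isClosed_le (by fun_prop) (by fun_prop)
    have h2 : IsClosed {z : ℝ × ℝ | z.2 ≤ 1} := isClosed_le (by fun_prop) (by fun_prop)
    exact (h1.inter h2).measurableSet
  rw [volume_revolution hm]
  have h : ∀ r ∈ Ioi (0 : ℝ), ENNReal.ofReal r * volume {x : ℝ | (x, r) ∈
      {z : ℝ × ℝ | a * |z.1| + y * z.2 ≤ 1 ∧ z.2 ≤ 1}} ≤
      (Ioc (0 : ℝ) 1).indicator (fun r => ENNReal.ofReal (r * (2 * ((1 - y * r) / a)))) r := by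
    intro r hr
    have hr' : 0 < r := hr
    by_cases h1 : r ≤ 1
    · rw [indicator_of_mem (show r ∈ Ioc (0 : ℝ) 1 from ⟨hr, h1⟩), ENNReal.ofReal_mul hr'.le]
      gcongr
      calc volume {x : ℝ | (x, r) ∈ {z : ℝ × ℝ | a * |z.1| + y * z.2 ≤ 1 ∧ z.2 ≤ 1}}
          ≤ volume (Icc (-((1 - y * r) / a)) ((1 - y * r) / a)) := by
            apply measure_mono
            rintro x ⟨hx, -⟩
            rw [mem_Icc, ← abs_le, le_div_iff₀ ha]
            simp only at hx
            linarith
        _ = _ := by rw [Real.volume_Icc]; congr 1; ring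
    · have : {x : ℝ | (x, r) ∈ {z : ℝ × ℝ | a * |z.1| + y * z.2 ≤ 1 ∧ z.2 ≤ 1}} = ∅ := by
        ext x; simp [h1]
      rw [this, measure_empty, mul_zero]
      exact zero_le
  have hint : ∫ r in (0 : ℝ)..1, r * (2 * ((1 - y * r) / a)) = (3 - 2 * y) / (3 * a) := by
    rw [intervalIntegral.integral_eq_sub_of_hasDerivAt
      (f := fun r => (r ^ 2 - 2 * y * r ^ 3 / 3) / a)]
    · field_simp; ring
    · intro r _
      refine (((hasDerivAt_pow 2 r).sub (((hasDerivAt_pow 3 r).const_mul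
        (2 * y)).div_const 3)).div_const a).congr_deriv ?_
      push_cast
      ring
    · exact Continuous.intervalIntegrable (by fun_prop) _ _
  have hsub : Ioc (0 : ℝ) 1 ∩ Ioi 0 = Ioc 0 1 := inter_eq_left.2 fun r hr => hr.1
  calc _ ≤ ENNReal.ofReal (2 * π) * ∫⁻ r in Ioi (0 : ℝ), (Ioc (0 : ℝ) 1).indicator
        (fun r => ENNReal.ofReal (r * (2 * ((1 - y * r) / a)))) r := by
        refine mul_le_mul_right ?_ _
        exact setLIntegral_mono' measurableSet_Ioi h
    _ = ENNReal.ofReal (2 * π) * ∫⁻ r in Ioc (0 : ℝ) 1,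
        ENNReal.ofReal (r * (2 * ((1 - y * r) / a))) := by
        rw [lintegral_indicator measurableSet_Ioc, Measure.restrict_restrict measurableSet_Ioc,
          hsub]
    _ = ENNReal.ofReal (2 * π) * ENNReal.ofReal ((3 - 2 * y) / (3 * a)) := by
        rw [← hint, intervalIntegral.integral_of_le zero_le_one,
          ofReal_integral_eq_lintegral_ofReal]
        · refine (intervalIntegrable_iff_integrableOn_Ioc_of_le zero_le_one).1 ?_
          exact Continuous.intervalIntegrable (by fun_prop) _ _
        · filter_upwards [ae_restrict_mem measurableSet_Ioc] with r hr
          have : 0 ≤ 1 - y * r := by nlinarith [hr.1, hr.2]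
          have := hr.1.le
          simp only [Pi.zero_apply]
          positivity
    _ = _ := by
        rw [← ENNReal.ofReal_mul (by positivity)]
        congr 1; ring

theorem volume_revolution_cap {a y s : ℝ} (ha : 0 < a) (hy : 0 < y) (hy1 : y < 1) (hs : 0 < s)
    (hsa : s ≤ a) :
    volume (revolution (cap a y s)) = ENNReal.ofReal (2 * π / (3 * a) *
      ((1 - y) ^ 2 * s * (3 * a - s * (1 + 2 * y)) / (a - s * y) ^ 2)) := by
  have hD : 0 < a - s * y := by nlinarith
  rw [volume_revolution (measurableSet_cap a y s)]
  set ρ := (a - s) / (a - s * y) with hρ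
  clear_value ρ
  have hρ0 : 0 ≤ ρ := hρ ▸ div_nonneg (by linarith) hD.le
  have hρ1 : ρ ≤ 1 := by rw [hρ, div_le_one hD]; nlinarith
  have hdiff : ∀ r, (1 - y * r) / a - (1 - r) / s = (a - s * y) / (s * a) * (r - ρ) := by
    intro r
    have hρD : ρ * (a - s * y) = a - s := by rw [hρ, div_mul_cancel₀ _ hD.ne']
    field_simp
    linear_combination hρD
  have hk : 0 < (a - s * y) / (s * a) := by positivity
  have h : ∀ r ∈ Ioi (0 : ℝ), ENNReal.ofReal r * volume {x : ℝ | (x, r) ∈ cap a y s} =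
      (Ioc ρ 1).indicator
        (fun r => ENNReal.ofReal (r * (2 * ((a - s * y) / (s * a) * (r - ρ))))) r := by
    intro r hr
    have hr' : 0 < r := hr
    by_cases h1 : r ∈ Ioc ρ 1
    · rw [indicator_of_mem h1, ENNReal.ofReal_mul hr'.le]
      congr 1
      have hpos : 0 ≤ (a - s * y) / (s * a) * (r - ρ) := mul_nonneg hk.le (by linarith [h1.1])
      have hl : 0 ≤ (1 - r) / s := div_nonneg (by linarith [h1.2]) hs.le
      have : {x : ℝ | (x, r) ∈ cap a y s} = Icc (-((1 - y * r) / a)) ((1 - y * r) / a) \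
          Icc (-((1 - r) / s)) ((1 - r) / s) := by
        ext x
        rw [mem_sdiff, mem_Icc, mem_Icc, ← abs_le, ← abs_le, le_div_iff₀ ha, le_div_iff₀ hs]
        simp only [cap, mem_ofPred_eq]
        constructor
        · rintro ⟨h2, -, h3⟩
          exact ⟨by linarith, by rw [not_le]; linarith⟩
        · rintro ⟨h2, h3⟩
          exact ⟨by linarith, h1.2, by rw [not_le] at h3; linarith⟩
      rw [this, measure_sdiff (Icc_subset_Icc (by linarith [hdiff r]) (by linarith [hdiff r]))
        measurableSet_Icc.nullMeasurableSet (by simp), Real.volume_Icc, Real.volume_Icc,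
        ← ENNReal.ofReal_sub _ (by linarith), ← hdiff]
      congr 1; ring
    · rw [indicator_of_notMem h1]
      have : {x : ℝ | (x, r) ∈ cap a y s} = ∅ := by
        ext x
        simp only [cap, mem_ofPred_eq, mem_empty_iff_false, iff_false]
        rintro ⟨h2, h3, h4⟩
        apply h1
        refine ⟨?_, h3⟩
        have h5 : |x| ≤ (1 - y * r) / a := by rw [le_div_iff₀ ha]; linarith
        have h6 : (1 - r) / s < |x| := by rw [div_lt_iff₀ hs]; linarith
        have h7 := hdiff r
        by_contra hc
        have : (a - s * y) / (s * a) * (r - ρ) ≤ 0 :=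
          mul_nonpos_of_nonneg_of_nonpos hk.le (by linarith)
        linarith
      simp [this]
  have hint : ∫ r in ρ..1, r * (2 * ((a - s * y) / (s * a) * (r - ρ))) =
      (1 - y) ^ 2 * s * (3 * a - s * (1 + 2 * y)) / (a - s * y) ^ 2 / (3 * a) := by
    rw [intervalIntegral.integral_eq_sub_of_hasDerivAt
      (f := fun r => (2 * ((a - s * y) / (s * a))) * (r ^ 3 / 3 - ρ * r ^ 2 / 2))]
    · rw [hρ]; field_simp; ring
    · intro r _
      refine ((((hasDerivAt_pow 3 r).div_const 3).sub (((hasDerivAt_pow 2 r).const_mul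
        ρ).div_const 2)).const_mul (2 * ((a - s * y) / (s * a)))).congr_deriv ?_
      push_cast
      ring
    · exact Continuous.intervalIntegrable (by fun_prop) _ _
  have hsub : Ioc ρ 1 ∩ Ioi 0 = Ioc ρ 1 := inter_eq_left.2 fun r hr => hρ0.trans_lt hr.1
  rw [setLIntegral_congr_fun measurableSet_Ioi h, lintegral_indicator measurableSet_Ioc,
    Measure.restrict_restrict measurableSet_Ioc,
    hsub, ← ofReal_integral_eq_lintegral_ofReal,
    ← intervalIntegral.integral_of_le hρ1, hint, ← ENNReal.ofReal_mul (by positivity)]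
  · congr 1; ring
  · refine (intervalIntegrable_iff_integrableOn_Ioc_of_le hρ1).1 ?_
    exact Continuous.intervalIntegrable (by fun_prop) _ _
  · filter_upwards [ae_restrict_mem measurableSet_Ioc] with r hr
    have h1 : 0 ≤ r - ρ := by linarith [hr.1]
    have h2 : 0 ≤ r := by linarith [hr.1]
    simp only [Pi.zero_apply]
    positivity

/-- The planar polar of the unconditional hull of `F ⊆ {x ≤ 0, y ≥ 0}`, on `{y ≥ 0}`. -/
def dualOf (F : Set (ℝ × ℝ)) : Set (ℝ × ℝ) :=
  {z | ∀ f ∈ F, -f.1 * |z.1| + f.2 * z.2 ≤ 1}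

theorem measurableSet_dualOf (F : Set (ℝ × ℝ)) : MeasurableSet (dualOf F) := by
  have : dualOf F = ⋂ f ∈ F, {z : ℝ × ℝ | -f.1 * |z.1| + f.2 * z.2 ≤ 1} := by
    ext z; simp [dualOf]
  rw [this]
  refine (isClosed_biInter fun f _ => ?_).measurableSet
  exact isClosed_le (by fun_prop) (by fun_prop)

theorem polar3_revolution_uncondOf {F : Set (ℝ × ℝ)} (hF : ∀ f ∈ F, f.1 ≤ 0 ∧ 0 ≤ f.2) :
    polar3 (revolution (uncondOf (convexHull ℝ F))) = revolution (dualOf F) := by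
  ext ⟨u, v, w⟩
  simp only [polar3, revolution, uncondOf, dualOf, mem_ofPred_eq, dot3]
  constructor
  · intro h f hf
    obtain ⟨hf1, hf2⟩ := hF f hf
    set σ := √(v ^ 2 + w ^ 2) with hσ
    have hσ2 : σ ^ 2 = v ^ 2 + w ^ 2 := sq_sqrt (by positivity)
    have hσ0 : 0 ≤ σ := sqrt_nonneg _
    obtain ⟨e, he, heu⟩ : ∃ e : ℝ, |e| = -f.1 ∧ u * e = -f.1 * |u| := by
      rcases le_total 0 u with h0 | h0
      · exact ⟨-f.1, abs_of_nonneg (by linarith), by rw [abs_of_nonneg h0]; ring⟩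
      · exact ⟨f.1, abs_of_nonpos hf1, by rw [abs_of_nonpos h0]; ring⟩
    rcases hσ0.eq_or_lt with h0 | h0
    · have := h (e, f.2, 0) (by
        simp only [he, neg_neg, ne_eq, OfNat.ofNat_ne_zero, not_false_eq_true, zero_pow, add_zero,
          sqrt_sq hf2, abs_of_nonneg hf2]
        exact subset_convexHull ℝ F hf)
      have hv : v = 0 := by nlinarith [sq_nonneg v, sq_nonneg w]
      simp only [hv] at this
      rw [← h0]
      linarith
    · have := h (e, f.2 * (v / σ), f.2 * (w / σ)) (by
        have : (f.2 * (v / σ)) ^ 2 + (f.2 * (w / σ)) ^ 2 = f.2 ^ 2 := by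
          field_simp
          rw [hσ2]
        simp only [he, neg_neg, this, sqrt_sq hf2, abs_of_nonneg hf2]
        exact subset_convexHull ℝ F hf)
      have h2 : v * (f.2 * (v / σ)) + w * (f.2 * (w / σ)) = f.2 * σ := by
        field_simp
        rw [hσ2]
      simp only at this
      linarith
  · rintro h ⟨x, y, z⟩ hq
    simp only at hq ⊢
    set σ := √(v ^ 2 + w ^ 2)
    have hconv : Convex ℝ {f : ℝ × ℝ | -f.1 * |u| + f.2 * σ ≤ 1} := by
      intro f hf g hg α β hα hβ hαβ
      simp only [mem_ofPred_eq, Prod.fst_add, Prod.snd_add, Prod.smul_fst, Prod.smul_snd,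
        smul_eq_mul] at hf hg ⊢
      nlinarith [mul_le_mul_of_nonneg_left hf hα, mul_le_mul_of_nonneg_left hg hβ]
    have hsub : F ⊆ {f : ℝ × ℝ | -f.1 * |u| + f.2 * σ ≤ 1} := fun f hf => h f hf
    have := convexHull_min hsub hconv hq
    simp only [mem_ofPred_eq, neg_neg, abs_of_nonneg (sqrt_nonneg _)] at this
    have h1 : u * x ≤ |x| * |u| := by rw [← abs_mul, mul_comm]; exact le_abs_self _
    have h2 : v * y + w * z ≤ √(y ^ 2 + z ^ 2) * σ := by
      rw [← sqrt_mul (by positivity)]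
      apply le_sqrt_of_sq_le
      nlinarith [sq_nonneg (v * z - w * y)]
    linarith

/-- Finite subsets of `[-1, 0] × [0, 1]` containing `(0, 0)` and `(0, 1)`. -/
structure IsVertexSet (F : Set (ℝ × ℝ)) : Prop where
  finite : F.Finite
  box : ∀ f ∈ F, -1 ≤ f.1 ∧ f.1 ≤ 0 ∧ 0 ≤ f.2 ∧ f.2 ≤ 1
  zero_mem : ((0 : ℝ), (0 : ℝ)) ∈ F
  top_mem : ((0 : ℝ), (1 : ℝ)) ∈ F

namespace IsVertexSet

variable {F : Set (ℝ × ℝ)}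

theorem isCompact_convexHull (hF : IsVertexSet F) : IsCompact (convexHull ℝ F) :=
  hF.finite.isCompact_convexHull ℝ

theorem box_of_mem_convexHull (hF : IsVertexSet F) {z : ℝ × ℝ} (hz : z ∈ convexHull ℝ F) :
    -1 ≤ z.1 ∧ z.1 ≤ 0 ∧ 0 ≤ z.2 ∧ z.2 ≤ 1 := by
  have hsub : F ⊆ Icc (-1 : ℝ) 0 ×ˢ Icc (0 : ℝ) 1 := fun f hf =>
    ⟨⟨(hF.box f hf).1, (hF.box f hf).2.1⟩, ⟨(hF.box f hf).2.2.1, (hF.box f hf).2.2.2⟩⟩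
  have := convexHull_min hsub ((convex_Icc _ _).prod (convex_Icc _ _)) hz
  exact ⟨this.1.1, this.1.2, this.2.1, this.2.2⟩

theorem axis_mem (hF : IsVertexSet F) {r : ℝ} (hr : 0 ≤ r) (hr1 : r ≤ 1) :
    ((0 : ℝ), r) ∈ convexHull ℝ F := by
  have := (convex_convexHull ℝ F) (subset_convexHull ℝ F hF.zero_mem)
    (subset_convexHull ℝ F hF.top_mem) (sub_nonneg.2 hr1) hr (by ring)
  simpa using this

theorem mem_of_le (hF : IsVertexSet F) {p q r : ℝ} (hp : 0 ≤ p) (hpq : p ≤ q)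
    (hq : (-q, r) ∈ convexHull ℝ F) : (-p, r) ∈ convexHull ℝ F := by
  obtain ⟨-, -, hr, hr1⟩ := hF.box_of_mem_convexHull hq
  rcases (hp.trans hpq).eq_or_lt with h0 | h0
  · rwa [show p = q by linarith]
  · have := (convex_convexHull ℝ F) (hF.axis_mem hr hr1) hq
      (sub_nonneg.2 (div_le_one_of_le₀ hpq h0.le)) (div_nonneg hp h0.le) (by ring)
    convert this using 1
    ext
    · simp; field_simp
    · simp; ring

theorem exists_slice_eq_Icc (hF : IsVertexSet F) {r : ℝ} (hr : 0 ≤ r) (hr1 : r ≤ 1) :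
    ∃ q, 0 ≤ q ∧ (-q, r) ∈ convexHull ℝ F ∧
      {x : ℝ | (x, r) ∈ uncondOf (convexHull ℝ F)} = Icc (-q) q := by
  have hc : IsCompact (Icc (0 : ℝ) 1 ∩ (fun p : ℝ => (-p, r)) ⁻¹' convexHull ℝ F) :=
    isCompact_Icc.inter_right (hF.isCompact_convexHull.isClosed.preimage (by fun_prop))
  obtain ⟨q, ⟨⟨hq0, -⟩, hq⟩, hmax⟩ := hc.exists_isGreatest
    ⟨0, ⟨le_refl _, zero_le_one⟩, by simpa using hF.axis_mem hr hr1⟩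
  refine ⟨q, hq0, hq, ?_⟩
  ext x
  simp only [uncondOf, mem_ofPred_eq, abs_of_nonneg hr, mem_Icc, ← abs_le]
  refine ⟨fun h => hmax ⟨⟨abs_nonneg x, ?_⟩, h⟩, fun h => hF.mem_of_le (abs_nonneg x) h hq⟩
  have := (hF.box_of_mem_convexHull h).1
  simp only at this
  linarith

theorem measurableSet_uncondOf (hF : IsVertexSet F) :
    MeasurableSet (uncondOf (convexHull ℝ F)) :=
  (hF.isCompact_convexHull.isClosed.preimage
    (f := fun p : ℝ × ℝ => (-|p.1|, |p.2|)) (by fun_prop)).measurableSet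

theorem volume_revolution_lt_top (hF : IsVertexSet F) :
    volume (revolution (uncondOf (convexHull ℝ F))) < ⊤ := by
  refine lt_of_le_of_lt (measure_mono (t := Icc (-1 : ℝ) 1 ×ˢ Icc (-1 : ℝ) 1 ×ˢ Icc (-1 : ℝ) 1) ?_)
    (isCompact_Icc.prod (isCompact_Icc.prod isCompact_Icc)).measure_lt_top
  rintro ⟨x, y, z⟩ h
  obtain ⟨h1, -, -, h2⟩ := hF.box_of_mem_convexHull h
  simp only [abs_of_nonneg (sqrt_nonneg _)] at h1 h2
  replace h2 := (sqrt_le_iff.1 h2).2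
  refine ⟨abs_le.1 (by linarith), abs_le.1 ?_, abs_le.1 ?_⟩
  · rw [← sq_le_one_iff_abs_le_one]; nlinarith [sq_nonneg z]
  · rw [← sq_le_one_iff_abs_le_one]; nlinarith [sq_nonneg y]

/-- Volumes of bodies of revolution are monotone under slicewise combinations. -/
theorem volume_revolution_combination_le {F₀ F₁ F₂ : Set (ℝ × ℝ)} (h₀ : IsVertexSet F₀)
    (h₁ : IsVertexSet F₁) (h₂ : IsVertexSet F₂) {l m : ℝ} (hl : 0 ≤ l) (hm : 0 ≤ m)
    (h : ∀ r p q, 0 < r → r ≤ 1 → 0 ≤ p → 0 ≤ q → (-p, r) ∈ convexHull ℝ F₀ →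
      (-q, r) ∈ convexHull ℝ F₁ → (-(l * p + m * q), r) ∈ convexHull ℝ F₂) :
    ENNReal.ofReal l * volume (revolution (uncondOf (convexHull ℝ F₀))) +
      ENNReal.ofReal m * volume (revolution (uncondOf (convexHull ℝ F₁))) ≤
      volume (revolution (uncondOf (convexHull ℝ F₂))) := by
  have hmeas : ∀ {F : Set (ℝ × ℝ)}, IsVertexSet F → Measurable fun r : ℝ =>
      ENNReal.ofReal r * volume {x : ℝ | (x, r) ∈ uncondOf (convexHull ℝ F)} := fun hF =>
    ENNReal.measurable_ofReal.mul (measurable_measure_prodMk_right hF.measurableSet_uncondOf)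
  rw [volume_revolution h₀.measurableSet_uncondOf, volume_revolution h₁.measurableSet_uncondOf,
    volume_revolution h₂.measurableSet_uncondOf, mul_left_comm, mul_left_comm (ENNReal.ofReal m),
    ← mul_add, ← lintegral_const_mul _ (hmeas h₀), ← lintegral_const_mul _ (hmeas h₁),
    ← lintegral_add_left ((hmeas h₀).const_mul _)]
  refine mul_le_mul_right (setLIntegral_mono' measurableSet_Ioi fun r (hr : 0 < r) => ?_) _
  by_cases hr1 : r ≤ 1
  · obtain ⟨p, hp, hp', hpe⟩ := h₀.exists_slice_eq_Icc hr.le hr1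
    obtain ⟨q, hq, hq', hqe⟩ := h₁.exists_slice_eq_Icc hr.le hr1
    have hsub : Icc (-(l * p + m * q)) (l * p + m * q) ⊆
        {x : ℝ | (x, r) ∈ uncondOf (convexHull ℝ F₂)} := by
      intro x hx
      rw [mem_Icc, ← abs_le] at hx
      simp only [uncondOf, mem_ofPred_eq, abs_of_pos hr]
      exact h₂.mem_of_le (abs_nonneg x) hx (h r p q hr hr1 hp hq hp' hq')
    rw [mul_left_comm, mul_left_comm (ENNReal.ofReal m), ← mul_add]
    refine mul_le_mul_right (le_trans (le_of_eq ?_) (measure_mono hsub)) _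
    rw [hpe, hqe, Real.volume_Icc, Real.volume_Icc, Real.volume_Icc, ← ENNReal.ofReal_mul hl,
      ← ENNReal.ofReal_mul hm, ← ENNReal.ofReal_add (mul_nonneg hl (by linarith))
      (mul_nonneg hm (by linarith))]
    congr 1; ring
  · have hempty : ∀ {F : Set (ℝ × ℝ)}, IsVertexSet F →
        {x : ℝ | (x, r) ∈ uncondOf (convexHull ℝ F)} = ∅ := by
      intro F hF
      ext x
      simp only [uncondOf, mem_ofPred_eq, mem_empty_iff_false, iff_false]
      intro hx
      have := (hF.box_of_mem_convexHull hx).2.2.2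
      simp only [abs_of_pos hr] at this
      exact hr1 this
    simp only [hempty h₀, hempty h₁, measure_empty, mul_zero, add_zero, zero_le]

end IsVertexSet

/-- The position of a vertex `g` relative to `(-a, y)` and `(-c, 1)`: it lies in the unit box,
not above `(-a, y)`, not on the left of the ray through `(-a, y)`, and below the line joining
`(-a, y)` and `(-c, 1)`. -/
structure IsLowVertex (a y c : ℝ) (g : ℝ × ℝ) : Prop where
  neg_one_le : -1 ≤ g.1
  nonpos : g.1 ≤ 0
  nonneg : 0 ≤ g.2
  le : g.2 ≤ y
  slope : a * g.2 ≤ y * -g.1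
  below : -g.1 * (1 - y) ≤ c * (1 - y) + (a - c) * (1 - g.2)

theorem combination_mem_convexHull {a y s c : ℝ} {G : Set (ℝ × ℝ)} (hy : 0 < y)
    (hy1 : y < 1) (hs : 0 < s) (hsc : s ≤ c) (hO : ((0 : ℝ), (0 : ℝ)) ∈ G)
    (hG : ∀ g ∈ G, g = (0, 1) ∨ IsLowVertex a y c g)
    (h₀ : IsVertexSet (insert (-a, y) G))
    (h₂ : IsVertexSet (insert (-s, 1) (insert (-a, y) G)))
    {r p q : ℝ} (hr1 : r ≤ 1) (hp : 0 ≤ p) (hq : 0 ≤ q)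
    (hpm : (-p, r) ∈ convexHull ℝ (insert (-a, y) G))
    (hqm : (-q, r) ∈ convexHull ℝ (insert (-c, 1) G)) :
    (-((c - s) / c * p + s / c * q), r) ∈
      convexHull ℝ (insert (-s, 1) (insert (-a, y) G)) := by
  have hc : 0 < c := hs.trans_le hsc
  have hlm : (c - s) / c + s / c = 1 := by field_simp; ring
  have hl : 0 ≤ (c - s) / c := div_nonneg (by linarith) hc.le
  have hm : 0 ≤ s / c := by positivity
  rcases le_total r y with hry | hry
  · suffices hq' : (-q, r) ∈ convexHull ℝ (insert (-a, y) G) by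
      have := convex_convexHull ℝ _ hpm hq' hl hm hlm
      refine convexHull_mono (subset_insert _ _) ?_
      convert this using 1
      ext
      · simp; ring
      · simp only [Prod.smul_mk, Prod.mk_add_mk, smul_eq_mul]; rw [← add_mul, hlm, one_mul]
    set G' : Set (ℝ × ℝ) := {g ∈ G | IsLowVertex a y c g} with hG'
    have hO' : ((0 : ℝ), (0 : ℝ)) ∈ G' := by
      refine ⟨hO, ?_⟩
      rcases hG _ hO with h | h
      · simp at h
      · exact h
    have hEc : Convex ℝ (Icc (-c) 0 ×ˢ {(1 : ℝ)}) := (convex_Icc _ _).prod (convex_singleton _)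
    have hsub : insert (-c, 1) G ⊆ (Icc (-c) 0 ×ˢ {(1 : ℝ)}) ∪ G' := by
      rintro g (rfl | hg)
      · exact Or.inl ⟨⟨le_refl _, by simp [hc.le]⟩, rfl⟩
      · rcases hG g hg with rfl | h
        · exact Or.inl ⟨⟨by simp [hc.le], le_refl _⟩, rfl⟩
        · exact Or.inr ⟨hg, h⟩
    have h := convexHull_mono (𝕜 := ℝ) hsub hqm
    have hne : (Icc (-c) 0 ×ˢ {(1 : ℝ)}).Nonempty := ⟨(0, 1), ⟨⟨by simp [hc.le], le_refl _⟩, rfl⟩⟩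
    have hne' : G'.Nonempty := ⟨_, hO'⟩
    rw [convexHull_union hne hne',
      hEc.convexHull_eq, mem_convexJoin] at h
    obtain ⟨⟨e, e'⟩, ⟨⟨he, he0⟩, he1⟩, ⟨g, g'⟩, hg, θ, η, hθ, hη, hθη, hz⟩ := h
    simp only [mem_singleton_iff] at he he0 he1
    subst he1
    have hgG : (g, g') ∈ convexHull ℝ (insert (-a, y) G) :=
      convexHull_mono (fun x hx => Or.inr hx.1) hg
    have hcv : Convex ℝ {g : ℝ × ℝ | g.2 ≤ y ∧ -g.1 * (1 - y) ≤ c * (1 - y) + (a - c) * (1 - g.2)} := by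
      rintro u ⟨hu, hu'⟩ v ⟨hv, hv'⟩ α β hα hβ hαβ
      obtain rfl : β = 1 - α := by linarith
      simp only [mem_ofPred_eq, Prod.fst_add, Prod.snd_add, Prod.smul_fst, Prod.smul_snd,
        smul_eq_mul]
      constructor
      · nlinarith
      · nlinarith [mul_le_mul_of_nonneg_left hu' hα, mul_le_mul_of_nonneg_left hv' hβ]
    have hsub' : G' ⊆ {g : ℝ × ℝ | g.2 ≤ y ∧ -g.1 * (1 - y) ≤ c * (1 - y) + (a - c) * (1 - g.2)} :=
      fun x hx => ⟨hx.2.le, hx.2.below⟩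
    obtain ⟨hgy, hgL⟩ := convexHull_min hsub' hcv hg
    simp only at hgy hgL
    obtain ⟨-, hg0, hg'0, -⟩ := h₀.box_of_mem_convexHull hgG
    simp only [Prod.smul_mk, Prod.mk_add_mk, smul_eq_mul, Prod.mk.injEq] at hz hg0 hg'0
    obtain ⟨hz1, hz2⟩ := hz
    obtain rfl : η = 1 - θ := by linarith
    -- the point of the segment from `(e, 1)` to `(g, g')` at height `y`
    have hg'1 : 0 < 1 - g' := by linarith
    set τ := (y - g') / (1 - g') with hτ
    have hτ0 : 0 ≤ τ := div_nonneg (by linarith) hg'1.le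
    have hτ1 : τ ≤ 1 := by rw [hτ, div_le_one hg'1]; linarith
    have hτg : τ * (1 - g') = y - g' := by rw [hτ]; field_simp
    have hθτ : θ ≤ τ := by rw [hτ, le_div_iff₀ hg'1]; linarith
    have hM : (-(-(τ * e + (1 - τ) * g)), y) ∈ convexHull ℝ (insert (-a, y) G) := by
      rw [neg_neg, ← neg_neg (τ * e + (1 - τ) * g)]
      refine h₀.mem_of_le (q := a) ?_ ?_ (subset_convexHull ℝ _ (mem_insert _ _))
      · nlinarith [mul_nonneg hτ0 (neg_nonneg.2 he0),
          mul_nonneg (sub_nonneg.2 hτ1) (neg_nonneg.2 hg0)]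
      · have h1 := mul_le_mul_of_nonneg_left hgL (sub_nonneg.2 hτ1)
        have h2 : (1 - τ) * (1 - g') = 1 - y := by linarith
        have h3 := mul_le_mul_of_nonneg_left he hτ0
        have h4 : (1 - τ) * -g * (1 - y) ≤ ((1 - τ) * c + (a - c)) * (1 - y) := by
          calc _ = (1 - τ) * (-g * (1 - y)) := by ring
            _ ≤ _ := h1
            _ = (1 - τ) * c * (1 - y) + (a - c) * ((1 - τ) * (1 - g')) := by ring
            _ = _ := by rw [h2]; ring
        have h5 := le_of_mul_le_mul_right h4 (by linarith)
        linarith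
    rw [neg_neg] at hM
    rcases hτ0.eq_or_lt with h0 | h0
    · obtain rfl : θ = 0 := by linarith
      have e1 : g = -q := by linarith
      have e2 : g' = r := by linarith
      rwa [e1, e2] at hgG
    · have := convex_convexHull ℝ _ hM hgG (a := θ / τ) (b := 1 - θ / τ) (by positivity)
        (sub_nonneg.2 ((div_le_one h0).2 hθτ)) (by ring)
      convert this using 1
      clear_value τ
      ext
      · simp only [Prod.smul_mk, Prod.mk_add_mk, smul_eq_mul]
        rw [← hz1]; field_simp; ring
      · simp only [Prod.smul_mk, Prod.mk_add_mk, smul_eq_mul]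
        rw [← hz2, show y = τ * (1 - g') + g' by linarith]; field_simp; ring
  · have hcv : ∀ α β γ : ℝ, Convex ℝ {g : ℝ × ℝ | α * g.1 + β * g.2 ≤ γ} := by
      intro α β γ u hu v hv ε δ hε hδ hεδ
      simp only [mem_ofPred_eq, Prod.fst_add, Prod.snd_add, Prod.smul_fst, Prod.smul_snd,
        smul_eq_mul] at hu hv ⊢
      obtain rfl : δ = 1 - ε := by linarith
      nlinarith [mul_le_mul_of_nonneg_left hu hε, mul_le_mul_of_nonneg_left hv hδ]
    have hp' : p * (1 - y) ≤ a * (1 - r) := by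
      have hsub : insert (-a, y) G ⊆ {g : ℝ × ℝ | -(1 - y) * g.1 + a * g.2 ≤ a} := by
        rintro g (rfl | hg)
        · simp only [mem_ofPred_eq]; linarith
        · rcases hG g hg with rfl | h
          · simp
          · have := h.below
            simp only [mem_ofPred_eq]
            nlinarith [h.le]
      have : -(1 - y) * -p + a * r ≤ a := convexHull_min hsub (hcv _ _ _) hpm
      linarith
    have hq' : q * (1 - y) ≤ c * (1 - y) + (a - c) * (1 - r) := by
      have hsub : insert (-c, 1) G ⊆
          {g : ℝ × ℝ | -(1 - y) * g.1 + (a - c) * g.2 ≤ c * (1 - y) + (a - c)} := by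
        rintro g (rfl | hg)
        · simp only [mem_ofPred_eq]; linarith
        · rcases hG g hg with rfl | h
          · simp only [mem_ofPred_eq]
            nlinarith
          · have := h.below
            simp only [mem_ofPred_eq]
            linarith
      have : -(1 - y) * -q + (a - c) * r ≤ c * (1 - y) + (a - c) :=
        convexHull_min hsub (hcv _ _ _) hqm
      linarith
    have hy1' : 0 < 1 - y := by linarith
    refine h₂.mem_of_le (q := s + (a - s) * ((1 - r) / (1 - y))) (by positivity) ?_ ?_
    · rw [← mul_le_mul_iff_of_pos_right hy1', ← mul_le_mul_iff_of_pos_right hc]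
      have e1 : ((c - s) / c * p + s / c * q) * (1 - y) * c =
        (c - s) * (p * (1 - y)) + s * (q * (1 - y)) := by field_simp
      have e2 : (s + (a - s) * ((1 - r) / (1 - y))) * (1 - y) * c =
        (s * (1 - y) + (a - s) * (1 - r)) * c := by field_simp
      rw [e1, e2]
      nlinarith [mul_le_mul_of_nonneg_left hp' (sub_nonneg.2 hsc),
        mul_le_mul_of_nonneg_left hq' hs.le]
    · have := convex_convexHull ℝ (insert (-s, 1) (insert (-a, y) G))
        (subset_convexHull ℝ _ (mem_insert _ _))
        (subset_convexHull ℝ _ (mem_insert_of_mem _ (mem_insert _ _)))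
        (a := 1 - (1 - r) / (1 - y)) (b := (1 - r) / (1 - y))
        (sub_nonneg.2 ((div_le_one hy1').2 (by linarith))) (div_nonneg (by linarith) hy1'.le)
        (by ring)
      convert this using 1
      ext
      · simp; ring
      · simp; field_simp; ring

theorem dualOf_mono {F₀ F₁ : Set (ℝ × ℝ)} (h : F₁ ⊆ convexHull ℝ F₀) : dualOf F₀ ⊆ dualOf F₁ := by
  intro z hz f hf
  have hconv : Convex ℝ {f : ℝ × ℝ | -f.1 * |z.1| + f.2 * z.2 ≤ 1} := by
    intro f hf g hg α β hα hβ hαβ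
    simp only [mem_ofPred_eq, Prod.fst_add, Prod.snd_add, Prod.smul_fst, Prod.smul_snd,
      smul_eq_mul] at hf hg ⊢
    nlinarith [mul_le_mul_of_nonneg_left hf hα, mul_le_mul_of_nonneg_left hg hβ]
  have hsub : F₀ ⊆ {f : ℝ × ℝ | -f.1 * |z.1| + f.2 * z.2 ≤ 1} := fun f hf => hz f hf
  exact convexHull_min hsub hconv (h hf)

theorem cap_subset_dualOf {a y s c : ℝ} {G : Set (ℝ × ℝ)} (ha : 0 < a) (hy : 0 < y)
    (hy1 : y < 1) (hs : 0 < s) (hsc : s ≤ c) (hca : c ≤ a)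
    (hG : ∀ g ∈ G, g = (0, 1) ∨ IsLowVertex a y c g) :
    cap a y s ⊆ dualOf (insert (-a, y) G) := by
  rintro ⟨u, v⟩ ⟨h1, h2, h3⟩ f hf
  simp only at h1 h2 h3 ⊢
  rcases hf with rfl | hf
  · simpa using h1
  rcases hG f hf with rfl | h
  · simpa using h2
  have hD : 0 < a - c * y := by nlinarith
  obtain ⟨f1, f2⟩ := f
  have hβ := h.slope
  have hb := h.below
  have hf1 := h.nonpos
  simp only at hβ hb hf1 ⊢
  have h3' : 1 < c * |u| + v := by nlinarith [abs_nonneg u]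
  -- `f = α (-a, y) - β (-c, 1)` with `α, β ≥ 0` and `α - β ≤ 1`
  have hα : 0 ≤ -f1 - c * f2 := by
    have : c * (a * f2) ≤ c * (y * -f1) := mul_le_mul_of_nonneg_left hβ (hs.le.trans hsc)
    have h4 : 0 ≤ (a - c * y) * -f1 := mul_nonneg hD.le (by linarith)
    have h5 : 0 ≤ a * (-f1 - c * f2) := by linarith
    exact nonneg_of_mul_nonneg_right h5 ha
  have hid : (a - c * y) * (-f1 * |u| + f2 * v) =
      (-f1 - c * f2) * (a * |u| + y * v) - (y * -f1 - a * f2) * (c * |u| + v) := by ring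
  have : (a - c * y) * (-f1 * |u| + f2 * v) ≤ (a - c * y) * 1 := by
    rw [hid]
    nlinarith [mul_le_mul_of_nonneg_left h1 hα,
      mul_le_mul_of_nonneg_left h3'.le (sub_nonneg.2 hβ)]
  exact le_of_mul_le_mul_left this hD

theorem volume_revolution_dualOf_add_cap {a y s c : ℝ} {G F : Set (ℝ × ℝ)} (ha : 0 < a)
    (hy : 0 < y) (hy1 : y < 1) (hs : 0 < s) (hsc : s ≤ c) (hca : c ≤ a)
    (hB : ((0 : ℝ), (1 : ℝ)) ∈ G)
    (hG : ∀ g ∈ G, g = (0, 1) ∨ IsLowVertex a y c g) (hsF : (-s, 1) ∈ F)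
    (hF : insert (-a, y) G ⊆ convexHull ℝ F)
    (hF' : F ⊆ insert (-s, 1) (insert (-a, y) G)) :
    volume (revolution (dualOf (insert (-a, y) G))) =
      volume (revolution (dualOf F)) + volume (revolution (cap a y s)) := by
  have hm : MeasurableSet (revolution (cap a y s)) :=
    (measurableSet_cap a y s).preimage
      (f := fun p : ℝ × ℝ × ℝ => (p.1, √(p.2.1 ^ 2 + p.2.2 ^ 2))) (by fun_prop)
  have hunion : revolution (dualOf (insert (-a, y) G)) =
      revolution (dualOf F) ∪ revolution (cap a y s) := by
    have : dualOf (insert (-a, y) G) = dualOf F ∪ cap a y s := by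
      apply Subset.antisymm
      · intro z hz
        by_cases h : s * |z.1| + z.2 ≤ 1
        · left
          intro f hf
          rcases hF' hf with rfl | hf
          · simpa using h
          · exact hz f hf
        · right
          have h1 := hz _ (mem_insert _ _)
          have h2 := hz _ (mem_insert_of_mem _ hB)
          simp only [neg_neg, neg_zero, zero_mul, zero_add, one_mul] at h1 h2
          exact ⟨h1, h2, not_le.1 h⟩
      · exact union_subset (dualOf_mono hF) (cap_subset_dualOf ha hy hy1 hs hsc hca hG)
    rw [this]
    rfl
  rw [hunion, measure_union _ hm]
  rw [Set.disjoint_left]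
  rintro z h1 ⟨-, -, h2⟩
  have := h1 _ hsF
  simp only [neg_neg, one_mul] at this
  exact absurd this (not_le.2 h2)

theorem min_mul_le_mul_of_combination {V₀ V V₂ W₀ W W₂ : ENNReal} {s c : ℝ} (hs : 0 < s)
    (hsc : s ≤ c) (hV₀ : V₀ ≠ ⊤) (hV : V ≠ ⊤) (hV₂ : V₂ ≠ ⊤) (hW₀ : W₀ ≠ ⊤) (hW : W ≠ ⊤)
    (hW₂ : W₂ ≠ ⊤)
    (h : ENNReal.ofReal ((c - s) / c) * V₀ + ENNReal.ofReal (s / c) * V₂ ≤ V)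
    (h' : c * W₀.toReal * W₂.toReal ≤ W.toReal * ((c - s) * W₂.toReal + s * W₀.toReal)) :
    min (V₀ * W₀) (V₂ * W₂) ≤ V * W := by
  have hc : 0 < c := hs.trans_le hsc
  have hl : 0 ≤ (c - s) / c := div_nonneg (by linarith) hc.le
  have hm : 0 ≤ s / c := by positivity
  have h1 := ENNReal.toReal_mono hV h
  rw [ENNReal.toReal_add (ENNReal.mul_ne_top ENNReal.ofReal_ne_top hV₀)
    (ENNReal.mul_ne_top ENNReal.ofReal_ne_top hV₂), ENNReal.toReal_mul, ENNReal.toReal_mul,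
    ENNReal.toReal_ofReal hl, ENNReal.toReal_ofReal hm] at h1
  have h2 : (c - s) * V₀.toReal + s * V₂.toReal ≤ c * V.toReal := by
    calc _ = c * ((c - s) / c * V₀.toReal + s / c * V₂.toReal) := by field_simp
      _ ≤ _ := mul_le_mul_of_nonneg_left h1 hc.le
  by_contra! hlt
  obtain ⟨hlt₀, hlt₂⟩ := lt_min_iff.1 hlt
  have k₀ := (ENNReal.toReal_lt_toReal (ENNReal.mul_ne_top hV hW)
    (ENNReal.mul_ne_top hV₀ hW₀)).2 hlt₀
  have k₂ := (ENNReal.toReal_lt_toReal (ENNReal.mul_ne_top hV hW)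
    (ENNReal.mul_ne_top hV₂ hW₂)).2 hlt₂
  simp only [ENNReal.toReal_mul] at k₀ k₂
  have n₀ : 0 ≤ V₀.toReal := ENNReal.toReal_nonneg
  have n₂ : 0 ≤ V₂.toReal := ENNReal.toReal_nonneg
  have n : 0 ≤ V.toReal := ENNReal.toReal_nonneg
  have m₀ : 0 ≤ W₀.toReal := ENNReal.toReal_nonneg
  have m₂ : 0 ≤ W₂.toReal := ENNReal.toReal_nonneg
  have m : 0 ≤ W.toReal := ENNReal.toReal_nonneg
  generalize V₀.toReal = v₀ at *
  generalize V₂.toReal = v₂ at *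
  generalize V.toReal = v at *
  generalize W₀.toReal = w₀ at *
  generalize W₂.toReal = w₂ at *
  generalize W.toReal = w at *
  have p₀ : 0 < w₀ := by
    rcases m₀.eq_or_lt with h0 | h0
    · rw [← h0] at k₀; nlinarith [mul_nonneg n m]
    · exact h0
  have p₂ : 0 < w₂ := by
    rcases m₂.eq_or_lt with h0 | h0
    · rw [← h0] at k₂; nlinarith [mul_nonneg n m]
    · exact h0
  have p : 0 < w := by
    rcases m.eq_or_lt with h0 | h0
    · rw [← h0, zero_mul] at h'
      exact absurd h' (not_le.2 (by positivity))
    · exact h0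
  have e1 : (c - s) * w₂ * (v * w) ≤ (c - s) * w₂ * (v₀ * w₀) :=
    mul_le_mul_of_nonneg_left k₀.le (mul_nonneg (by linarith) p₂.le)
  have e2 : s * w₀ * (v * w) < s * w₀ * (v₂ * w₂) := mul_lt_mul_of_pos_left k₂ (by positivity)
  have e3 := mul_le_mul_of_nonneg_left h2 (mul_pos p₀ p₂).le
  have e4 := mul_le_mul_of_nonneg_left h' n
  linarith

theorem min_mahler3_le {a y s c : ℝ} {G : Set (ℝ × ℝ)} (ha1 : a ≤ 1) (hy : 0 < y)
    (hy1 : y < 1) (hs : 0 < s) (hsc : s ≤ c) (hca : c ≤ a) (hGfin : G.Finite)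
    (hO : ((0 : ℝ), (0 : ℝ)) ∈ G) (hB : ((0 : ℝ), (1 : ℝ)) ∈ G)
    (hG : ∀ g ∈ G, g = (0, 1) ∨ IsLowVertex a y c g)
    (ha : (-a, y) ∈ convexHull ℝ (insert (-c, 1) G)) :
    min (mahler3 (revolution (uncondOf (convexHull ℝ (insert (-a, y) G)))))
        (mahler3 (revolution (uncondOf (convexHull ℝ (insert (-c, 1) G))))) ≤
      mahler3 (revolution (uncondOf (convexHull ℝ (insert (-s, 1) (insert (-a, y) G))))) := by
  have hc : 0 < c := hs.trans_le hsc
  have ha0 : 0 < a := hc.trans_le hca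
  have hbox : ∀ g ∈ G, -1 ≤ g.1 ∧ g.1 ≤ 0 ∧ 0 ≤ g.2 ∧ g.2 ≤ 1 := by
    intro g hg
    rcases hG g hg with rfl | h
    · norm_num
    · exact ⟨h.neg_one_le, h.nonpos, h.nonneg, h.le.trans hy1.le⟩
  have h₀ : IsVertexSet (insert (-a, y) G) := by
    refine ⟨hGfin.insert _, ?_, mem_insert_of_mem _ hO, mem_insert_of_mem _ hB⟩
    rintro f (rfl | hf)
    · exact ⟨by simpa using ha1, by simpa using ha0.le, hy.le, hy1.le⟩
    · exact hbox f hf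
  have h₁ : IsVertexSet (insert (-c, 1) G) := by
    refine ⟨hGfin.insert _, ?_, mem_insert_of_mem _ hO, mem_insert_of_mem _ hB⟩
    rintro f (rfl | hf)
    · exact ⟨by simpa using hca.trans ha1, by simpa using hc.le, zero_le_one, le_refl _⟩
    · exact hbox f hf
  have h₂ : IsVertexSet (insert (-s, 1) (insert (-a, y) G)) := by
    refine ⟨h₀.finite.insert _, ?_, mem_insert_of_mem _ h₀.zero_mem,
      mem_insert_of_mem _ h₀.top_mem⟩
    rintro f (rfl | hf)
    · exact ⟨by simpa using hsc.trans (hca.trans ha1), by simpa using hs.le, zero_le_one,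
        le_refl _⟩
    · exact h₀.box f hf
  have hneg : ∀ {F}, IsVertexSet F → ∀ f ∈ F, f.1 ≤ 0 ∧ 0 ≤ f.2 := fun hF f hf =>
    ⟨(hF.box f hf).2.1, (hF.box f hf).2.2.1⟩
  simp only [mahler3, polar3_revolution_uncondOf (hneg h₀), polar3_revolution_uncondOf (hneg h₁),
    polar3_revolution_uncondOf (hneg h₂)]
  have hWs := volume_revolution_dualOf_add_cap ha0 hy hy1 hs hsc hca hB hG
    (mem_insert (-s, 1) (insert (-a, y) G))
    ((subset_insert _ _).trans (subset_convexHull ℝ _)) (Subset.refl _)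
  have hWc := volume_revolution_dualOf_add_cap (F := insert (-c, 1) G) ha0 hy hy1 hc le_rfl hca hB
    hG (mem_insert _ _) (insert_subset ha ((subset_insert _ _).trans (subset_convexHull ℝ _)))
    (insert_subset_insert (subset_insert _ _))
  have hW0 : volume (revolution (dualOf (insert (-a, y) G))) ≤
      ENNReal.ofReal (2 * π / (3 * a) * (3 - 2 * y)) := by
    refine (measure_mono ?_).trans (volume_revolution_trapezoid_le ha0 hy1)
    intro z hz
    have k1 := hz _ (mem_insert _ _)
    have k2 := hz _ (mem_insert_of_mem _ hB)
    simp only [neg_neg, neg_zero, zero_mul, zero_add, one_mul] at k1 k2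
    exact ⟨k1, k2⟩
  have hW0t := (hW0.trans_lt ENNReal.ofReal_lt_top).ne
  have hWst := ne_top_of_le_ne_top hW0t (hWs ▸ le_self_add)
  have hWct := ne_top_of_le_ne_top hW0t (hWc ▸ le_self_add)
  refine min_mul_le_mul_of_combination hs hsc h₀.volume_revolution_lt_top.ne
    h₂.volume_revolution_lt_top.ne h₁.volume_revolution_lt_top.ne hW0t hWst hWct ?_ ?_
  · refine IsVertexSet.volume_revolution_combination_le h₀ h₁ h₂
      (div_nonneg (by linarith) hc.le) (by positivity) ?_
    intro r p q _ hr1 hp hq hpm hqm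
    exact combination_mem_convexHull hy hy1 hs hsc hO hG h₀ h₂ hr1 hp hq hpm hqm
  · set g : ℝ → ℝ := fun x => (1 - y) ^ 2 * x * (3 * a - x * (1 + 2 * y)) / (a - x * y) ^ 2 with hg
    have hcap : ∀ x, 0 < x → x ≤ a → volume (revolution (cap a y x)) =
        ENNReal.ofReal (2 * π / (3 * a) * g x) ∧ 0 ≤ 2 * π / (3 * a) * g x := by
      intro x hx hxa
      refine ⟨volume_revolution_cap ha0 hy hy1 hx hxa, ?_⟩
      have : 0 ≤ 3 * a - x * (1 + 2 * y) := by nlinarith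
      simp only [hg]
      positivity
    obtain ⟨es, ps⟩ := hcap s hs (hsc.trans hca)
    obtain ⟨ec, pc⟩ := hcap c hc hca
    have hWs' := congrArg ENNReal.toReal hWs
    have hWc' := congrArg ENNReal.toReal hWc
    rw [es, ENNReal.toReal_add hWst ENNReal.ofReal_ne_top, ENNReal.toReal_ofReal ps] at hWs'
    rw [ec, ENNReal.toReal_add hWct ENNReal.ofReal_ne_top, ENNReal.toReal_ofReal pc] at hWc'
    have hw := ENNReal.toReal_mono ENNReal.ofReal_ne_top hW0
    rw [ENNReal.toReal_ofReal (mul_nonneg (by positivity) (by linarith))] at hw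
    have := weighted_cap_convexity ha0 hy hy1 hs hsc hca (by positivity) ENNReal.toReal_nonneg hw g fun x => rfl
    rw [eq_sub_of_add_eq hWs'.symm, eq_sub_of_add_eq hWc'.symm]
    exact this

/-- A point of the cone spanned by `u` and `v` that is not beyond the line through `u` and `v`
lies in the triangle with vertices `0`, `u`, `v`. -/
theorem mem_convexHull_of_cross {S : Set (ℝ × ℝ)} {u v z : ℝ × ℝ}
    (hO : ((0 : ℝ), (0 : ℝ)) ∈ S) (hu : u ∈ S) (hv : v ∈ S)
    (huv : 0 < u.1 * v.2 - u.2 * v.1) (hzv : 0 ≤ z.1 * v.2 - z.2 * v.1)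
    (huz : 0 ≤ u.1 * z.2 - u.2 * z.1)
    (h : (z.1 * v.2 - z.2 * v.1) + (u.1 * z.2 - u.2 * z.1) ≤ u.1 * v.2 - u.2 * v.1) :
    z ∈ convexHull ℝ S := by
  rcases (add_nonneg hzv huz).eq_or_lt with h0 | h0
  · have e1 : z.1 * v.2 - z.2 * v.1 = 0 := by linarith
    have e2 : u.1 * z.2 - u.2 * z.1 = 0 := by linarith
    have hz1 : z.1 = 0 := by
      have : (u.1 * v.2 - u.2 * v.1) * z.1 = 0 := by linear_combination u.1 * e1 + v.1 * e2
      exact (mul_eq_zero.1 this).resolve_left huv.ne'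
    have hz2 : z.2 = 0 := by
      have : (u.1 * v.2 - u.2 * v.1) * z.2 = 0 := by linear_combination u.2 * e1 + v.2 * e2
      exact (mul_eq_zero.1 this).resolve_left huv.ne'
    exact subset_convexHull ℝ S (by rwa [show z = (0, 0) from Prod.ext hz1 hz2])
  · set α := z.1 * v.2 - z.2 * v.1 with hα
    set β := u.1 * z.2 - u.2 * z.1 with hβ
    set δ := u.1 * v.2 - u.2 * v.1 with hδ
    have hw := convex_convexHull ℝ S (subset_convexHull ℝ S hu) (subset_convexHull ℝ S hv)
      (a := α / (α + β)) (b := β / (α + β)) (by positivity) (by positivity) (by field_simp)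
    have := convex_convexHull ℝ S (subset_convexHull ℝ S hO) hw
      (a := 1 - (α + β) / δ) (b := (α + β) / δ) (sub_nonneg.2 ((div_le_one huv).2 h))
      (by positivity) (by ring)
    have k1 : δ * z.1 = α * u.1 + β * v.1 := by rw [hα, hβ, hδ]; ring
    have k2 : δ * z.2 = α * u.2 + β * v.2 := by rw [hα, hβ, hδ]; ring
    clear_value α β δ
    convert this using 1
    ext
    · simp only [Prod.fst_add, Prod.smul_fst, smul_eq_mul]
      field_simp
      linear_combination k1
    · simp only [Prod.snd_add, Prod.smul_snd, smul_eq_mul]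
      field_simp
      linear_combination k2

/-- Lemma 3.5 of the paper: cutting off the vertex `A₁` of the 1-unconditional
polygon with quadrant part `conv{A₁,…,A_{n-1},D,O,B}` — either by deleting `A₁`
(giving `P₁`) or by sliding it along `AB` to the point `C` where the line `A₂A₃`
meets the line `y = 1` (giving `P₂`) — does not increase the minimum: the Mahler
volume of the body of revolution generated by `P` is at least the minimum of
those generated by `P₁` and `P₂`.  Slopes of `OA_i` being increasing is stated in
the cross-product form `(A i).2 * (A j).1 < (A j).2 * (A i).1` (valid since all
abscissae are nonpositive), and "the `A_i` are vertices" is stated as each `A i`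
not lying in the convex hull of the remaining points.  For `n = 3` the point `A₃`
is taken to be `D = (-1,0)`. -/
theorem mahler_min_polygon_step (n : ℕ) (hn : 3 ≤ n) (A : ℕ → ℝ × ℝ) (t : ℝ)
    (ht : 0 ≤ t) (ht1 : t ≤ 1) (hA1 : A 1 = (-t, 1))
    (hintr : ∀ i, 2 ≤ i → i ≤ n - 1 →
      -1 < (A i).1 ∧ (A i).2 < 1 ∧ (A i).1 + 1 < (A i).2)
    (hslopes : ∀ i j, 1 ≤ i → i < j → j ≤ n - 1 →
      (A i).2 * (A j).1 < (A j).2 * (A i).1)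
    (hvert : ∀ i, 1 ≤ i → i ≤ n - 1 →
      A i ∉ convexHull ℝ ((A '' {j | 1 ≤ j ∧ j ≤ n - 1 ∧ j ≠ i}) ∪
        {((-1 : ℝ), (0 : ℝ)), (0, 0), (0, 1)}))
    (A₃ : ℝ × ℝ) (hA₃ : A₃ = if n = 3 then ((-1 : ℝ), (0 : ℝ)) else A 3)
    (C : ℝ × ℝ)
    (hC : C = ((A 2).1 + (1 - (A 2).2) * (A₃.1 - (A 2).1) / (A₃.2 - (A 2).2), 1))
    (P P₁ P₂ : Set (ℝ × ℝ))
    (hP : P = uncondOf (convexHull ℝ ((A '' {j | 1 ≤ j ∧ j ≤ n - 1}) ∪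
      {((-1 : ℝ), (0 : ℝ)), (0, 0), (0, 1)})))
    (hP₁ : P₁ = uncondOf (convexHull ℝ ((A '' {j | 2 ≤ j ∧ j ≤ n - 1}) ∪
      {((-1 : ℝ), (0 : ℝ)), (0, 0), (0, 1)})))
    (hP₂ : P₂ = uncondOf (convexHull ℝ ((A '' {j | 3 ≤ j ∧ j ≤ n - 1}) ∪
      {C, ((-1 : ℝ), (0 : ℝ)), (0, 0), (0, 1)}))) :
    min (mahler3 (revolution P₁)) (mahler3 (revolution P₂)) ≤ mahler3 (revolution P) := by
  set G : Set (ℝ × ℝ) := (A '' {j | 3 ≤ j ∧ j ≤ n - 1}) ∪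
    {((-1 : ℝ), (0 : ℝ)), (0, 0), (0, 1)} with hGdef
  have hD : ((-1 : ℝ), (0 : ℝ)) ∈ G := Or.inr (by simp)
  have hO : ((0 : ℝ), (0 : ℝ)) ∈ G := Or.inr (by simp)
  have hB : ((0 : ℝ), (1 : ℝ)) ∈ G := Or.inr (by simp)
  have hAG : ∀ i, 3 ≤ i → i ≤ n - 1 → A i ∈ G := fun i h1 h2 => Or.inl ⟨i, ⟨h1, h2⟩, rfl⟩
  have hGfin : G.Finite :=
    (((Set.finite_Icc 3 (n - 1)).subset fun j hj => ⟨hj.1, hj.2⟩).image A).union (by simp)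
  have hF₁ : (A '' {j | 2 ≤ j ∧ j ≤ n - 1}) ∪ {((-1 : ℝ), (0 : ℝ)), (0, 0), (0, 1)} =
      insert (A 2) G := by
    have : {j | 2 ≤ j ∧ j ≤ n - 1} = insert 2 {j | 3 ≤ j ∧ j ≤ n - 1} := by
      ext j; simp only [mem_ofPred_eq, mem_insert_iff]; omega
    rw [this, image_insert_eq, insert_union]
  have hF : (A '' {j | 1 ≤ j ∧ j ≤ n - 1}) ∪ {((-1 : ℝ), (0 : ℝ)), (0, 0), (0, 1)} =
      insert (A 1) (insert (A 2) G) := by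
    have : {j | 1 ≤ j ∧ j ≤ n - 1} = insert 1 {j | 2 ≤ j ∧ j ≤ n - 1} := by
      ext j; simp only [mem_ofPred_eq, mem_insert_iff]; omega
    rw [this, image_insert_eq, insert_union, hF₁]
  have hF₂ : (A '' {j | 3 ≤ j ∧ j ≤ n - 1}) ∪ {C, ((-1 : ℝ), (0 : ℝ)), (0, 0), (0, 1)} =
      insert C G := by
    rw [union_insert]
  have hmemX : ∀ {i j}, 1 ≤ j → j ≤ n - 1 → j ≠ i → A j ∈
      (A '' {j | 1 ≤ j ∧ j ≤ n - 1 ∧ j ≠ i}) ∪ {((-1 : ℝ), (0 : ℝ)), (0, 0), (0, 1)} :=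
    fun h1 h2 h3 => Or.inl ⟨_, ⟨h1, h2, h3⟩, rfl⟩
  have hDX : ∀ i, ((-1 : ℝ), (0 : ℝ)) ∈
      (A '' {j | 1 ≤ j ∧ j ≤ n - 1 ∧ j ≠ i}) ∪ {((-1 : ℝ), (0 : ℝ)), (0, 0), (0, 1)} :=
    fun i => Or.inr (by simp)
  have hOX : ∀ i, ((0 : ℝ), (0 : ℝ)) ∈
      (A '' {j | 1 ≤ j ∧ j ≤ n - 1 ∧ j ≠ i}) ∪ {((-1 : ℝ), (0 : ℝ)), (0, 0), (0, 1)} :=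
    fun i => Or.inr (by simp)
  have hBX : ∀ i, ((0 : ℝ), (1 : ℝ)) ∈
      (A '' {j | 1 ≤ j ∧ j ≤ n - 1 ∧ j ≠ i}) ∪ {((-1 : ℝ), (0 : ℝ)), (0, 0), (0, 1)} :=
    fun i => Or.inr (by simp)
  have ht0 : 0 < t := by
    refine ht.lt_of_ne fun h => hvert 1 le_rfl (by omega) (subset_convexHull ℝ _ ?_)
    rw [hA1, ← h, neg_zero]
    exact hBX 1
  obtain ⟨hx2, hy2, hxy2⟩ := hintr 2 le_rfl (by omega)
  have h12 := hslopes 1 2 le_rfl (by omega) (by omega)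
  rw [hA1] at h12
  obtain ⟨a, ha⟩ : ∃ a, a = -(A 2).1 := ⟨_, rfl⟩
  obtain ⟨y, hy⟩ : ∃ y, y = (A 2).2 := ⟨_, rfl⟩
  have hA2 : A 2 = (-a, y) := Prod.ext (by simp [ha]) (by simp [hy])
  simp only [hA2] at hx2 hy2 hxy2 h12
  have hy0 : 0 < y := by linarith
  have ha0 : 0 < a := by nlinarith
  -- the later vertices are lower than `A 2`
  have hlow : ∀ i, 3 ≤ i → i ≤ n - 1 → (A i).2 < y := by
    intro i hi hi'
    by_contra! hc
    have hsl := hslopes 2 i (by omega) (by omega) hi'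
    have hi1 := (hintr i (by omega) hi').2.1
    rw [hA2] at hsl
    simp only at hsl
    have hpa : a ≤ -(A i).1 := by
      have : y * a ≤ y * -(A i).1 := by nlinarith
      exact le_of_mul_le_mul_left this hy0
    refine hvert 2 (by omega) (by omega)
      (mem_convexHull_of_cross (hOX 2) (hBX 2) (hmemX (by omega) hi' (by omega)) ?_ ?_ ?_ ?_)
    all_goals simp only [hA2]
    · linarith
    · linarith
    · linarith
    · nlinarith [mul_nonneg (sub_nonneg.2 hpa) (sub_nonneg.2 hy2.le),
        mul_nonneg ha0.le (sub_nonneg.2 hc)]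
  have hpos : ∀ i, 2 ≤ i → i ≤ n - 1 → 0 < (A i).2 := by
    intro i hi hi'
    have := hintr i hi hi'
    linarith
  -- the position of `A₃`, and of the other vertices relative to the line through `A 2` and `A₃`
  obtain ⟨h3y, h30, h3G, hbelow, ht3⟩ : A₃.2 < y ∧ 0 ≤ A₃.2 ∧ A₃ ∈ G ∧
      (∀ V, V = ((-1 : ℝ), (0 : ℝ)) ∨ (∃ i, 3 ≤ i ∧ i ≤ n - 1 ∧ A i = V) →
        (-V.1 - a) * (y - A₃.2) ≤ (-A₃.1 - a) * (y - V.2)) ∧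
      t * (y - A₃.2) ≤ a * (1 - A₃.2) - -A₃.1 * (1 - y) := by
    rcases hn.eq_or_lt with h | h
    · rw [if_pos h.symm] at hA₃
      subst hA₃
      refine ⟨hy0, le_rfl, hD, ?_, ?_⟩
      · rintro V (rfl | ⟨i, hi, hi', -⟩)
        · exact le_rfl
        · omega
      · by_contra! hc
        refine hvert 2 (by omega) (by omega) (mem_convexHull_of_cross (hOX 2)
          (hmemX (i := 2) (j := 1) le_rfl (by omega) (by omega)) (hDX 2) ?_ ?_ ?_ ?_)
        all_goals simp only [hA2, hA1] at hc ⊢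
        all_goals linarith
    · rw [if_neg (by omega)] at hA₃
      subst hA₃
      have h23 := hslopes 2 3 (by omega) (by omega) (by omega)
      rw [hA2] at h23
      simp only at h23
      refine ⟨hlow 3 le_rfl (by omega), (hpos 3 (by omega) (by omega)).le,
        hAG 3 le_rfl (by omega), ?_, ?_⟩
      · have hgen : ∀ V ∈ (A '' {j | 1 ≤ j ∧ j ≤ n - 1 ∧ j ≠ 3}) ∪
            {((-1 : ℝ), (0 : ℝ)), (0, 0), (0, 1)}, 0 < -a * V.2 - y * V.1 →
            0 ≤ (A 3).1 * V.2 - (A 3).2 * V.1 →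
            (-V.1 - a) * (y - (A 3).2) ≤ (-(A 3).1 - a) * (y - V.2) := by
          intro V hV hV2 hV3
          by_contra! hc
          refine hvert 3 (by omega) (by omega) (mem_convexHull_of_cross (hOX 3)
            (hmemX (i := 3) (j := 2) (by omega) (by omega) (by omega)) hV ?_ hV3 ?_ ?_)
          all_goals simp only [hA2]
          all_goals linarith
        rintro V (rfl | ⟨i, hi, hi', rfl⟩)
        · exact hgen _ (hDX 3) (by simpa using hy0)
            (by simpa using (hpos 3 (by omega) (by omega)).le)
        · rcases hi.eq_or_lt with rfl | hi3
          · exact le_rfl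
          · have h2i := hslopes 2 i (by omega) (by omega) hi'
            have h3i := hslopes 3 i (by omega) (by omega) hi'
            rw [hA2] at h2i
            simp only at h2i
            exact hgen _ (hmemX (by omega) hi' (by omega)) (by linarith) (by linarith)
      · by_contra! hc
        have h13 := hslopes 1 3 le_rfl (by omega) (by omega)
        rw [hA1] at h13
        simp only at h13
        refine hvert 2 (by omega) (by omega) (mem_convexHull_of_cross (hOX 2)
          (hmemX (i := 2) (j := 1) le_rfl (by omega) (by omega))
          (hmemX (i := 2) (j := 3) (by omega) (by omega) (by omega)) ?_ ?_ ?_ ?_)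
        all_goals simp only [hA2, hA1]
        all_goals linarith
  have h3pos : 0 < y - A₃.2 := by linarith
  have h1y : 0 < 1 - y := by linarith
  obtain ⟨q, hq⟩ : ∃ q, q = (-A₃.1 - a) / (y - A₃.2) := ⟨_, rfl⟩
  have hq3 : q * (y - A₃.2) = -A₃.1 - a := by rw [hq, div_mul_cancel₀ _ h3pos.ne']
  have hVq : ∀ V : ℝ × ℝ, (-V.1 - a) * (y - A₃.2) ≤ (-A₃.1 - a) * (y - V.2) →
      -V.1 ≤ a + q * (y - V.2) := by
    intro V hV
    have : (-V.1 - a) * (y - A₃.2) ≤ q * (y - V.2) * (y - A₃.2) := by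
      calc _ ≤ _ := hV
        _ = _ := by rw [← hq3]; ring
    linarith [le_of_mul_le_mul_right this h3pos]
  have hq0 : 0 ≤ q := by
    have := hVq _ (hbelow _ (Or.inl rfl))
    simp only [sub_zero, neg_neg] at this
    by_contra! hneg
    nlinarith
  obtain ⟨c, hc⟩ : ∃ c, c = a - (1 - y) * q := ⟨_, rfl⟩
  have hCc : C = (-c, 1) := by
    rw [hC, hA2, hc, hq, Prod.mk.injEq]
    refine ⟨?_, rfl⟩
    have h3neg : A₃.2 - y ≠ 0 := by linarith
    have := h3pos.ne'
    simp only
    field_simp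
    ring
  have htc : t ≤ c := by
    have : t * (y - A₃.2) ≤ c * (y - A₃.2) := by
      calc _ ≤ _ := ht3
        _ = a * (y - A₃.2) - (1 - y) * (-A₃.1 - a) := by ring
        _ = c * (y - A₃.2) := by rw [← hq3, hc]; ring
    exact le_of_mul_le_mul_right this h3pos
  have hca : c ≤ a := by rw [hc]; nlinarith
  have hbelow' : ∀ V : ℝ × ℝ, -V.1 ≤ a + q * (y - V.2) →
      -V.1 * (1 - y) ≤ c * (1 - y) + (a - c) * (1 - V.2) := by
    intro V hV
    have := mul_le_mul_of_nonneg_right hV h1y.le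
    rw [hc]
    linarith
  rw [hP, hP₁, hP₂, hF, hF₁, hF₂, hA1, hA2, hCc]
  refine min_mahler3_le (by linarith) hy0 hy2 ht0 htc hca hGfin hO hB ?_ ?_
  · rintro g (⟨i, ⟨hi, hi'⟩, rfl⟩ | hg)
    · right
      have hsl := hslopes 2 i (by omega) (by omega) hi'
      obtain ⟨k1, -, k3⟩ := hintr i (by omega) hi'
      have k4 := hpos i (by omega) hi'
      rw [hA2] at hsl
      simp only at hsl
      have k5 : (A i).1 ≤ 0 := by
        by_contra! hneg
        nlinarith [mul_pos hy0 hneg, mul_pos k4 ha0]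
      exact ⟨k1.le, k5, k4.le, (hlow i hi hi').le, by linarith,
        hbelow' _ (hVq _ (hbelow _ (Or.inr ⟨i, hi, hi', rfl⟩)))⟩
    · simp only [mem_insert_iff, mem_singleton_iff] at hg
      rcases hg with rfl | rfl | rfl
      · right
        exact ⟨le_rfl, by norm_num, le_rfl, hy0.le, by simpa using hy0.le,
          hbelow' _ (hVq _ (hbelow _ (Or.inl rfl)))⟩
      · right
        refine ⟨by norm_num, le_rfl, le_rfl, hy0.le, by simp, ?_⟩
        have : 0 ≤ c * (1 - y) := mul_nonneg (ht.trans htc) h1y.le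
        simp only
        linarith
      · exact Or.inl rfl
  · have h31 : 0 < 1 - A₃.2 := by linarith
    have := convex_convexHull ℝ (insert (-c, 1) G) (subset_convexHull ℝ _ (mem_insert _ _))
      (subset_convexHull ℝ _ (mem_insert_of_mem _ h3G))
      (a := 1 - (1 - y) / (1 - A₃.2)) (b := (1 - y) / (1 - A₃.2))
      (sub_nonneg.2 ((div_le_one h31).2 (by linarith))) (by positivity) (by ring)
    convert this using 1
    ext
    · simp only [Prod.fst_add, Prod.smul_fst, smul_eq_mul]
      field_simp
      rw [hc]
      linear_combination (-(1 - y)) * hq3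
    · simp only [Prod.snd_add, Prod.smul_snd, smul_eq_mul]
      field_simp
      ring
end
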